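/- Let Γ ≤ Aut(A²) be a finitely generated subgroup that is not of bounded degree. Then the invariant ring k[x,y]^Γ = {f ∈ k[x,y] : φ(f) = f for all φ ∈ Γ} consists exactly of the constants, i.e., k[x,y]^Γ = k. -/

import Mathlib

open MvPolynomial

variable {k : Type*} [Field k]

/-- The subgroup `Aff` of affine automorphisms: both components have degree `1`. -/
def IsAff (φ : MvPolynomial (Fin 2) k ≃ₐ[k] MvPolynomial (Fin 2) k) : Prop :=
  (φ (X 0)).totalDegree = 1 ∧ (φ (X 1)).totalDegree = 1

/-- The de Jonquières subgroup `J`: automorphisms of the form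
`(a x + P(y), b y + c)` with `a, b ∈ kˣ`, `c ∈ k`, `P ∈ k[y]`. -/
def IsJonq (φ : MvPolynomial (Fin 2) k ≃ₐ[k] MvPolynomial (Fin 2) k) : Prop :=
  ∃ (a b : kˣ) (c : k) (P : Polynomial k),
    φ (X 0) = C (a : k) * X 0 + Polynomial.aeval (X 1) P ∧
      φ (X 1) = C (b : k) * X 1 + C c

/-- The degree of a polynomial automorphism: the maximum of the total degrees of its two
components. -/
noncomputable def adeg (φ : MvPolynomial (Fin 2) k ≃ₐ[k] MvPolynomial (Fin 2) k) : ℕ :=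
  max (φ (X 0)).totalDegree (φ (X 1)).totalDegree

section Weights

variable {σ τ : Type*} [Fintype σ] [Fintype τ]

/-- weight of an exponent vector -/
noncomputable def wt (w : σ → ℚ) (d : σ →₀ ℕ) : ℚ := ∑ i, (d i : ℚ) * w i

lemma wt_add (w : σ → ℚ) (d e : σ →₀ ℕ) : wt w (d + e) = wt w d + wt w e := by
  simp [wt, add_mul, Finset.sum_add_distrib]

lemma wt_zero (w : σ → ℚ) : wt w 0 = 0 := by simp [wt]

lemma wt_single [DecidableEq σ] (w : σ → ℚ) (i : σ) (n : ℕ) :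
    wt w (Finsupp.single i n) = n * w i := by
  unfold wt
  rw [Finset.sum_eq_single i]
  · simp
  · intro b _ hb
    simp [Finsupp.single_apply, hb.symm]
  · simp

/-- all monomials of `g` have weight at most `l` -/
def WLe (w : σ → ℚ) (l : ℚ) (g : MvPolynomial σ k) : Prop :=
  ∀ d, coeff d g ≠ 0 → wt w d ≤ l

/-- the weight `l` part of `g` -/
noncomputable def wtop (w : σ → ℚ) (l : ℚ) (g : MvPolynomial σ k) : MvPolynomial σ k :=
  ∑ d ∈ g.support, if wt w d = l then monomial d (coeff d g) else 0

lemma coeff_wtop (w : σ → ℚ) (l : ℚ) (g : MvPolynomial σ k) (d : σ →₀ ℕ) :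
    coeff d (wtop w l g) = if wt w d = l then coeff d g else 0 := by
  classical
  unfold wtop
  rw [coeff_sum]
  by_cases hd : d ∈ g.support
  · rw [Finset.sum_eq_single d]
    · split_ifs <;> simp
    · intro b _ hb
      split_ifs
      · simp [coeff_monomial, hb]
      · simp
    · intro h; exact absurd hd h
  · rw [Finset.sum_eq_zero]
    · rw [notMem_support_iff] at hd
      simp [hd]
    · intro b hb
      have : b ≠ d := by rintro rfl; exact hd hb
      split_ifs
      · simp [coeff_monomial, this]
      · simp

lemma WLe.mono {w : σ → ℚ} {l l' : ℚ} {g : MvPolynomial σ k} (h : WLe w l g) (hl : l ≤ l') :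
    WLe w l' g := fun d hd => (h d hd).trans hl

lemma WLe.add {w : σ → ℚ} {l : ℚ} {g h : MvPolynomial σ k} (hg : WLe w l g) (hh : WLe w l h) :
    WLe w l (g + h) := by
  intro d hd
  rw [coeff_add] at hd
  by_cases h1 : coeff d g = 0
  · by_cases h2 : coeff d h = 0
    · simp [h1, h2] at hd
    · exact hh d h2
  · exact hg d h1

lemma WLe.neg {w : σ → ℚ} {l : ℚ} {g : MvPolynomial σ k} (hg : WLe w l g) :
    WLe w l (-g) := by
  intro d hd
  rw [coeff_neg] at hd
  exact hg d (by simpa using hd)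

lemma WLe.sub {w : σ → ℚ} {l : ℚ} {g h : MvPolynomial σ k} (hg : WLe w l g) (hh : WLe w l h) :
    WLe w l (g - h) := by
  rw [sub_eq_add_neg]; exact hg.add hh.neg

lemma WLe.zero {w : σ → ℚ} {l : ℚ} : WLe w l (0 : MvPolynomial σ k) := by
  intro d hd; simp at hd

lemma WLe.sum {ι : Type*} {w : σ → ℚ} {l : ℚ} (s : Finset ι) (g : ι → MvPolynomial σ k)
    (h : ∀ i ∈ s, WLe w l (g i)) : WLe w l (∑ i ∈ s, g i) := by
  classical
  induction s using Finset.induction_on with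
  | empty => simpa using WLe.zero
  | insert a s ha ih =>
    rw [Finset.sum_insert ha]
    exact (h a (by simp)).add (ih fun i hi => h i (by simp [hi]))

lemma WLe.mul {w : σ → ℚ} {l l' : ℚ} {g h : MvPolynomial σ k} (hg : WLe w l g) (hh : WLe w l' h) :
    WLe w (l + l') (g * h) := by
  classical
  intro d hd
  rw [coeff_mul] at hd
  obtain ⟨⟨a, b⟩, hab, hne⟩ := Finset.exists_ne_zero_of_sum_ne_zero hd
  rw [Finset.HasAntidiagonal.mem_antidiagonal] at hab
  have := hg a (left_ne_zero_of_mul hne)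
  have := hh b (right_ne_zero_of_mul hne)
  rw [← hab, wt_add]
  linarith

lemma WLe.C {w : σ → ℚ} (c : k) : WLe w 0 (C c : MvPolynomial σ k) := by
  classical
  intro d hd
  rw [coeff_C] at hd
  split_ifs at hd with h
  · rw [← h, wt_zero]
  · simp at hd

lemma WLe.one {w : σ → ℚ} : WLe w 0 (1 : MvPolynomial σ k) := WLe.C 1

lemma WLe.pow {w : σ → ℚ} {l : ℚ} {g : MvPolynomial σ k} (hg : WLe w l g) (n : ℕ) :
    WLe w (n * l) (g ^ n) := by
  induction n with
  | zero => simpa using WLe.one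
  | succ n ih =>
    rw [pow_succ]
    have := ih.mul hg
    refine this.mono (le_of_eq ?_)
    push_cast; ring

lemma WLe.X [DecidableEq σ] {w : σ → ℚ} (i : σ) : WLe w (w i) (X i : MvPolynomial σ k) := by
  intro d hd
  rw [coeff_X] at hd
  split_ifs at hd with h
  · rw [← h, wt_single]; simp
  · simp at hd

lemma WLe.prod {ι : Type*} {w : σ → ℚ} (s : Finset ι) (l : ι → ℚ) (g : ι → MvPolynomial σ k)
    (h : ∀ i ∈ s, WLe w (l i) (g i)) : WLe w (∑ i ∈ s, l i) (∏ i ∈ s, g i) := by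
  classical
  induction s using Finset.induction_on with
  | empty => simpa using WLe.one
  | insert a s ha ih =>
    rw [Finset.sum_insert ha, Finset.prod_insert ha]
    exact (h a (by simp)).mul (ih fun i hi => h i (by simp [hi]))

lemma wtop_add (w : σ → ℚ) (l : ℚ) (g h : MvPolynomial σ k) :
    wtop w l (g + h) = wtop w l g + wtop w l h := by
  ext d; simp only [coeff_wtop, coeff_add]; split_ifs <;> simp

lemma wtop_sub (w : σ → ℚ) (l : ℚ) (g h : MvPolynomial σ k) :
    wtop w l (g - h) = wtop w l g - wtop w l h := by
  ext d; simp only [coeff_wtop, coeff_sub]; split_ifs <;> simp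

lemma wtop_zero (w : σ → ℚ) (l : ℚ) : wtop w l (0 : MvPolynomial σ k) = 0 := by
  ext d; simp [coeff_wtop]

lemma wtop_sum {ι : Type*} (w : σ → ℚ) (l : ℚ) (s : Finset ι) (g : ι → MvPolynomial σ k) :
    wtop w l (∑ i ∈ s, g i) = ∑ i ∈ s, wtop w l (g i) := by
  classical
  induction s using Finset.induction_on with
  | empty => simp [wtop_zero]
  | insert a s ha ih => rw [Finset.sum_insert ha, Finset.sum_insert ha, wtop_add, ih]

lemma wtop_eq_zero {w : σ → ℚ} {l l' : ℚ} {g : MvPolynomial σ k} (h : WLe w l g) (hl : l < l') :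
    wtop w l' g = 0 := by
  ext d
  rw [coeff_wtop]
  split_ifs with h1
  · by_contra h2
    have := h d (by simpa using h2)
    linarith
  · simp

lemma wtop_mul {w : σ → ℚ} {l l' : ℚ} {g h : MvPolynomial σ k} (hg : WLe w l g)
    (hh : WLe w l' h) : wtop w (l + l') (g * h) = wtop w l g * wtop w l' h := by
  classical
  ext d
  rw [coeff_wtop, coeff_mul, coeff_mul]
  split_ifs with h1
  · refine Finset.sum_congr rfl ?_
    rintro ⟨a, b⟩ hab
    rw [Finset.HasAntidiagonal.mem_antidiagonal] at hab
    simp only [coeff_wtop]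
    simp only at hab
    rw [← hab, wt_add] at h1
    by_cases ha : coeff a g = 0
    · simp [ha]
    by_cases hb : coeff b h = 0
    · simp [hb]
    have := hg a ha
    have := hh b hb
    rw [if_pos (by linarith), if_pos (by linarith)]
  · symm
    refine Finset.sum_eq_zero ?_
    rintro ⟨a, b⟩ hab
    rw [Finset.HasAntidiagonal.mem_antidiagonal] at hab
    simp only at hab
    rw [← hab, wt_add] at h1
    simp only [coeff_wtop]
    by_cases ha : wt w a = l
    · by_cases hb : wt w b = l'
      · exact absurd (by rw [ha, hb]) h1
      · simp [hb]
    · simp [ha]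

lemma wtop_C (w : σ → ℚ) (c : k) : wtop w 0 (C c : MvPolynomial σ k) = C c := by
  classical
  ext d
  rw [coeff_wtop, coeff_C]
  by_cases h : 0 = d
  · subst h; simp [wt_zero]
  · simp [h]

lemma wtop_X [DecidableEq σ] (w : σ → ℚ) (i : σ) :
    wtop w (w i) (X i : MvPolynomial σ k) = X i := by
  ext d
  rw [coeff_wtop, coeff_X]
  by_cases h : Finsupp.single i 1 = d
  · subst h; simp [wt_single]
  · simp [h]

lemma wtop_pow {w : σ → ℚ} {l : ℚ} {g : MvPolynomial σ k} (hg : WLe w l g) (n : ℕ) :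
    wtop w (n * l) (g ^ n) = wtop w l g ^ n := by
  induction n with
  | zero => simpa using wtop_C w (1 : k)
  | succ n ih =>
    rw [pow_succ, pow_succ, ← ih, ← wtop_mul (hg.pow n) hg]
    congr 1; push_cast; ring

lemma wtop_prod {ι : Type*} {w : σ → ℚ} (s : Finset ι) (l : ι → ℚ) (g : ι → MvPolynomial σ k)
    (h : ∀ i ∈ s, WLe w (l i) (g i)) :
    wtop w (∑ i ∈ s, l i) (∏ i ∈ s, g i) = ∏ i ∈ s, wtop w (l i) (g i) := by
  classical
  induction s using Finset.induction_on with
  | empty => simpa using wtop_C w (1 : k)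
  | insert a s ha ih =>
    have h' : ∀ i ∈ s, WLe w (l i) (g i) := fun i hi => h i (by simp [hi])
    rw [Finset.sum_insert ha, Finset.prod_insert ha, Finset.prod_insert ha, ← ih h',
      wtop_mul (h a (by simp)) (WLe.prod s l g h')]

lemma exists_wtop (w : σ → ℚ) {g : MvPolynomial σ k} (hg : g ≠ 0) :
    ∃ l, WLe w l g ∧ wtop w l g ≠ 0 ∧ ∃ d, coeff d g ≠ 0 ∧ wt w d = l := by
  have hs : g.support.Nonempty := by
    rw [Finset.nonempty_iff_ne_empty]; simpa using hg
  obtain ⟨d, hd, hmax⟩ := Finset.exists_max_image g.support (wt w) hs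
  rw [mem_support_iff] at hd
  refine ⟨wt w d, fun e he => hmax e (by rwa [mem_support_iff]), ?_, d, hd, rfl⟩
  intro h0
  have := congrArg (coeff d) h0
  rw [coeff_wtop, if_pos rfl] at this
  exact hd (by simpa using this)

lemma monomial_subst (Φ : MvPolynomial σ k →ₐ[k] MvPolynomial τ k) (d : σ →₀ ℕ) (c : k) :
    Φ (monomial d c) = C c * ∏ i, Φ (X i) ^ d i := by
  rw [monomial_eq, map_mul, Finsupp.prod_fintype _ _ (by simp), map_prod]
  simp only [map_pow]
  congr 1
  exact Φ.commutes c

lemma subst_monomial_le {w : σ → ℚ} {w' : τ → ℚ} (Φ : MvPolynomial σ k →ₐ[k] MvPolynomial τ k)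
    (hΦ : ∀ i, WLe w' (w i) (Φ (X i))) (d : σ →₀ ℕ) (c : k) :
    WLe w' (wt w d) (Φ (monomial d c)) := by
  rw [monomial_subst, ← zero_add (wt w d)]
  exact (WLe.C c).mul (WLe.prod _ _ _ fun i _ => (hΦ i).pow (d i))

lemma subst_le {w : σ → ℚ} {w' : τ → ℚ} (Φ : MvPolynomial σ k →ₐ[k] MvPolynomial τ k)
    (hΦ : ∀ i, WLe w' (w i) (Φ (X i))) {l : ℚ} {g : MvPolynomial σ k} (hg : WLe w l g) :
    WLe w' l (Φ g) := by
  rw [g.as_sum, map_sum]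
  refine WLe.sum _ _ fun d hd => ?_
  exact (subst_monomial_le Φ hΦ d _).mono (hg d (by rwa [mem_support_iff] at hd))

lemma subst_top {w : σ → ℚ} {w' : τ → ℚ} (Φ : MvPolynomial σ k →ₐ[k] MvPolynomial τ k)
    (hΦ : ∀ i, WLe w' (w i) (Φ (X i))) {l : ℚ} {g : MvPolynomial σ k} (hg : WLe w l g) :
    wtop w' l (Φ g) = aeval (fun i => wtop w' (w i) (Φ (X i))) (wtop w l g) := by
  conv_lhs => rw [g.as_sum, map_sum, wtop_sum]
  rw [wtop, map_sum]
  refine Finset.sum_congr rfl fun d hd => ?_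
  have hle := hg d (by rwa [mem_support_iff] at hd)
  split_ifs with h
  · rw [← h, monomial_subst, monomial_subst, ← zero_add (wt w d)]
    change wtop w' (0 + ∑ i, (d i : ℚ) * w i) _ = _
    rw [wtop_mul (WLe.C _) (WLe.prod _ _ _ fun i _ => (hΦ i).pow (d i)), wtop_C]
    rw [wtop_prod _ _ _ fun i _ => (hΦ i).pow (d i)]
    congr 1
    refine Finset.prod_congr rfl fun i _ => ?_
    rw [wtop_pow (hΦ i), aeval_X]
  · rw [map_zero]
    exact wtop_eq_zero (subst_monomial_le Φ hΦ d _) (lt_of_le_of_ne hle h)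

end Weights

section LemmaF

open Polynomial in
lemma F_zero {R : Type*} [CommRing R] [IsDomain R] (D : Derivation ℤ R R) {a b : ℕ}
    (ha : (a : R) = 0) (hb : (b : R) ≠ 0) (hb2 : 2 ≤ b) {c1 c2 x y : R} (hc2 : c2 ≠ 0)
    (hx : x ≠ 0) (hDx : D x = 1) (hD1 : D c1 = 0) (hD2 : D c2 = 0)
    {A B : Polynomial R}
    (h : Polynomial.C c1 * A ^ a + Polynomial.C c2 * B ^ b
      = Polynomial.C (c1 * y ^ a + c2 * x ^ b)) : B.natDegree = 0 := by
  let Δ : Derivation ℤ R[X] R[X] :=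
    (PolynomialModule.equivPolynomialSelf : PolynomialModule R R ≃ₗ[R[X]] R[X]).toLinearMap.compDer
      D.mapCoeffs
  have hΔC : ∀ r, Δ (Polynomial.C r) = Polynomial.C (D r) := by
    intro r
    ext n
    change D ((Polynomial.C r).coeff n) = _
    rw [Polynomial.coeff_C, Polynomial.coeff_C]
    split_ifs <;> simp
  have haP : (a : R[X]) = 0 := by
    rw [← Polynomial.C_eq_natCast, ha, Polynomial.C_0]
  have e := congrArg Δ h
  simp only [map_add, Derivation.leibniz, hΔC, Derivation.leibniz_pow, hD1, hD2, hDx] at e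
  simp only [smul_eq_mul, nsmul_eq_mul, haP, ha, zero_mul, mul_zero, map_zero, add_zero, zero_add,
    mul_one, map_mul, map_natCast] at e
  have hbP : (b : R[X]) ≠ 0 := by
    rw [← Polynomial.C_eq_natCast]; exact Polynomial.C_ne_zero.2 hb
  have hcP : (Polynomial.C c2 : R[X]) ≠ 0 := by simpa using hc2
  have e2 : B ^ (b - 1) * Δ B = Polynomial.C (x ^ (b - 1)) :=
    mul_left_cancel₀ hbP (mul_left_cancel₀ hcP e)
  have hne : (Polynomial.C (x ^ (b - 1)) : R[X]) ≠ 0 := by simpa using pow_ne_zero _ hx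
  rw [← e2] at hne
  have h3 := congrArg natDegree e2
  rw [natDegree_mul (left_ne_zero_of_mul hne) (right_ne_zero_of_mul hne), natDegree_C,
    natDegree_pow] at h3
  have h4 : (b - 1) * B.natDegree = 0 := by omega
  rcases Nat.mul_eq_zero.1 h4 with h | h
  · omega
  · exact h

open Polynomial in
lemma F_deg {R : Type*} [CommRing R] [IsDomain R] {a b : ℕ} {c1 c2 v : R}
    (h1 : c1 ≠ 0) (h2 : c2 ≠ 0) {A B : Polynomial R}
    (h : Polynomial.C c1 * A ^ a + Polynomial.C c2 * B ^ b = Polynomial.C v) :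
    a * A.natDegree = b * B.natDegree := by
  have e : Polynomial.C c1 * A ^ a = - (Polynomial.C c2 * B ^ b) + Polynomial.C v := by
    rw [← h]; ring
  have := congrArg natDegree e
  rw [natDegree_add_C, natDegree_neg, natDegree_C_mul h1, natDegree_C_mul h2, natDegree_pow,
    natDegree_pow] at this
  exact this

open Polynomial in
lemma F_der {R : Type*} [CommRing R] [IsDomain R] {a b : ℕ} (ha : (a : R) ≠ 0) (hb : (b : R) ≠ 0)
    (ha2 : 2 ≤ a) (hb2 : 2 ≤ b) {c1 c2 v : R}
    (h1 : c1 ≠ 0) (h2 : c2 ≠ 0) (hv : v ≠ 0) {A B : Polynomial R}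
    (h : Polynomial.C c1 * A ^ a + Polynomial.C c2 * B ^ b = Polynomial.C v) :
    derivative A = 0 ∧ derivative B = 0 := by
  have hd := F_deg h1 h2 h
  have e := congrArg derivative h
  rw [derivative_add, derivative_C_mul, derivative_C_mul, derivative_pow, derivative_pow,
    derivative_C] at e
  set A' := derivative A with hA'
  set B' := derivative B with hB'
  set W := Polynomial.C (a : R) * A' * B - Polynomial.C (b : R) * A * B' with hW
  have pa : A ^ a = A ^ (a-1) * A := by rw [← pow_succ]; congr 1; omega
  have pb : B ^ b = B ^ (b-1) * B := by rw [← pow_succ]; congr 1; omega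
  rw [pa, pb] at h
  have eA : Polynomial.C c1 * A ^ (a-1) * W = - (Polynomial.C (b : R) * Polynomial.C v * B') := by
    rw [hW, ← h]; linear_combination B * e
  have eB : Polynomial.C c2 * B ^ (b-1) * W = Polynomial.C (a : R) * Polynomial.C v * A' := by
    rw [hW, ← h]; linear_combination (- A) * e
  have haP : Polynomial.C (a : R) ≠ 0 := Polynomial.C_ne_zero.2 ha
  have hbP : Polynomial.C (b : R) ≠ 0 := Polynomial.C_ne_zero.2 hb
  have hvP : Polynomial.C v ≠ 0 := by simpa using hv
  by_cases hW0 : W = 0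
  · rw [hW0, mul_zero] at eA eB
    constructor
    · have := eB.symm
      exact (mul_eq_zero.1 this).resolve_left (mul_ne_zero haP hvP)
    · have := eA.symm
      exact (mul_eq_zero.1 (neg_eq_zero.1 this)).resolve_left (mul_ne_zero hbP hvP)
  exfalso
  by_cases hA0 : A = 0
  · have hA'0 : A' = 0 := by simp [hA', hA0]
    apply hW0; rw [hW, hA'0, hA0]; simp
  by_cases hB0 : B = 0
  · have hB'0 : B' = 0 := by simp [hB', hB0]
    apply hW0; rw [hW, hB'0, hB0]; simp
  have dA := congrArg natDegree eA
  have dB := congrArg natDegree eB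
  rw [natDegree_neg, mul_assoc, mul_assoc, natDegree_C_mul h1, natDegree_C_mul hb,
    natDegree_C_mul hv, natDegree_mul (pow_ne_zero _ hA0) hW0, natDegree_pow] at dA
  rw [mul_assoc, mul_assoc, natDegree_C_mul h2, natDegree_C_mul ha,
    natDegree_C_mul hv, natDegree_mul (pow_ne_zero _ hB0) hW0, natDegree_pow] at dB
  have hA'0 : A.natDegree ≠ 0 := by
    intro h0
    have hB0' : B.natDegree = 0 := by
      rw [h0, mul_zero] at hd
      rcases Nat.mul_eq_zero.1 hd.symm with h | h
      · omega
      · exact h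
    apply hW0
    have e1 : A' = 0 := by rw [hA', eq_C_of_natDegree_eq_zero h0, derivative_C]
    have e2 : B' = 0 := by rw [hB', eq_C_of_natDegree_eq_zero hB0', derivative_C]
    rw [hW, e1, e2]; simp
  have hB'0 : B.natDegree ≠ 0 := by
    intro h0
    rw [h0, mul_zero] at hd
    rcases Nat.mul_eq_zero.1 hd with h | h <;> omega
  have l1 : A'.natDegree < A.natDegree := natDegree_derivative_lt hA'0
  have l2 : B'.natDegree < B.natDegree := natDegree_derivative_lt hB'0
  have m1 : A.natDegree ≤ (a-1) * A.natDegree := Nat.le_mul_of_pos_left _ (by omega)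
  have m2 : B.natDegree ≤ (b-1) * B.natDegree := Nat.le_mul_of_pos_left _ (by omega)
  omega

open Polynomial in
lemma F_nz {R : Type*} [CommRing R] [IsDomain R] {a b : ℕ} (ha : (a : R) ≠ 0) (hb : (b : R) ≠ 0)
    (ha2 : 2 ≤ a) (hb2 : 2 ≤ b) {c1 c2 v : R}
    (h1 : c1 ≠ 0) (h2 : c2 ≠ 0) (hv : v ≠ 0) (n : ℕ) : ∀ {A B : Polynomial R},
    Polynomial.C c1 * A ^ a + Polynomial.C c2 * B ^ b = Polynomial.C v → A.natDegree ≤ n →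
    A.natDegree = 0 := by
  obtain ⟨p, hp⟩ := CharP.exists R
  induction n with
  | zero => intro A B _ h; omega
  | succ n ih =>
    intro A B h hn
    obtain ⟨dA, dB⟩ := F_der ha hb ha2 hb2 h1 h2 hv h
    rcases CharP.char_is_prime_or_zero R p with hpp | rfl
    · have eA := expand_contract p dA hpp.ne_zero
      have eB := expand_contract p dB hpp.ne_zero
      rw [← eA, ← eB, ← Polynomial.expand_C p c1, ← Polynomial.expand_C p c2, ← Polynomial.expand_C p v, ← map_pow, ← map_pow,
        ← map_mul, ← map_mul, ← map_add] at h
      have h' := expand_injective hpp.pos h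
      rw [← eA, natDegree_expand] at hn ⊢
      by_contra hne
      have h0 : (contract p A).natDegree ≠ 0 := by
        intro h0; apply hne; rw [h0]; simp
      have := hpp.two_le
      exact h0 (ih h' (by nlinarith [Nat.pos_of_ne_zero h0]))
    · have : CharZero R := CharP.charP_to_charZero R
      have : IsAddTorsionFree R := inferInstance
      exact derivative_eq_zero.1 dA

open Polynomial in
lemma lemmaF {R : Type*} [CommRing R] [IsDomain R] (D1 D2 : Derivation ℤ R R) {a b : ℕ}
    (hab : Nat.Coprime a b) (ha2 : 2 ≤ a) (hb2 : 2 ≤ b) {c1 c2 x y : R} (hc1 : c1 ≠ 0)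
    (hc2 : c2 ≠ 0) (hx : x ≠ 0) (hy : y ≠ 0) (hDx : D1 x = 1) (hDy : D2 y = 1)
    (hD1 : D1 c1 = 0 ∧ D1 c2 = 0) (hD2 : D2 c1 = 0 ∧ D2 c2 = 0)
    (hv : c1 * y ^ a + c2 * x ^ b ≠ 0)
    {A B : Polynomial R}
    (h : Polynomial.C c1 * A ^ a + Polynomial.C c2 * B ^ b
      = Polynomial.C (c1 * y ^ a + c2 * x ^ b)) : A.natDegree = 0 ∧ B.natDegree = 0 := by
  have hd := F_deg hc1 hc2 h
  obtain ⟨p, hp⟩ := CharP.exists R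
  have key : A.natDegree = 0 ∨ B.natDegree = 0 := by
    by_cases ha : (a : R) = 0
    · right
      have hb : (b : R) ≠ 0 := by
        intro hb
        rw [CharP.cast_eq_zero_iff R p] at ha hb
        have := Nat.dvd_gcd ha hb
        rw [hab] at this
        exact CharP.char_ne_one R p (Nat.dvd_one.1 this)
      exact F_zero D1 ha hb hb2 hc2 hx hDx hD1.1 hD1.2 h
    · left
      by_cases hb : (b : R) = 0
      · rw [add_comm, add_comm (c1 * _)] at h
        exact F_zero D2 hb ha ha2 hc1 hy hDy hD2.2 hD2.1 h
      · exact F_nz ha hb ha2 hb2 hc1 hc2 hv _ h le_rfl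
  rcases key with h0 | h0
  · refine ⟨h0, ?_⟩
    rw [h0, mul_zero] at hd
    rcases Nat.mul_eq_zero.1 hd.symm with h | h
    · omega
    · exact h
  · refine ⟨?_, h0⟩
    rw [h0, mul_zero] at hd
    rcases Nat.mul_eq_zero.1 hd with h | h
    · omega
    · exact h

end LemmaF

section LemmaE

/-- specialise the extra variable to zero -/
noncomputable def pi0 : MvPolynomial (Option (Fin 2)) k →ₐ[k] MvPolynomial (Fin 2) k :=
  aeval (fun o : Option (Fin 2) => o.elim 0 X)

lemma X_none_dvd (g : MvPolynomial (Option (Fin 2)) k) :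
    (X none : MvPolynomial (Option (Fin 2)) k) ∣ g - rename some (pi0 g) := by
  induction g using MvPolynomial.induction_on with
  | C c => simp [pi0]
  | add p q hp hq =>
    have := dvd_add hp hq
    rw [map_add, map_add]
    convert this using 1; ring
  | mul_X p o hp =>
    rw [map_mul, map_mul]
    cases o with
    | none => simp [pi0]
    | some i =>
      have : rename some (pi0 (X (some i) : MvPolynomial (Option (Fin 2)) k)) = X (some i) := by
        simp [pi0]
      rw [this, ← sub_mul]
      exact hp.mul_right _

lemma coeff_none_zero (g : MvPolynomial (Option (Fin 2)) k) (d : Option (Fin 2) →₀ ℕ)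
    (hd : d none = 0) : coeff d g = coeff d (rename some (pi0 g)) := by
  obtain ⟨h, hh⟩ := X_none_dvd g
  rw [← sub_eq_zero, ← coeff_sub, hh, mul_comm, coeff_mul_X', if_neg]
  simpa using hd

lemma coeff_rename_some {r : MvPolynomial (Fin 2) k} {d : Option (Fin 2) →₀ ℕ}
    (hd : coeff d (rename some r) ≠ 0) : d none = 0 := by
  obtain ⟨u, hu, -⟩ := coeff_rename_ne_zero _ _ _ hd
  rw [← hu]
  exact Finsupp.mapDomain_of_notMem_range _ _ (by simp)

lemma pi0_eq_zero {g : MvPolynomial (Option (Fin 2)) k}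
    (h : ∀ d, coeff d g ≠ 0 → d none ≠ 0) : pi0 g = 0 := by
  rw [g.as_sum, map_sum]
  refine Finset.sum_eq_zero fun d hd => ?_
  rw [monomial_subst]
  have := h d (by simpa using hd)
  rw [Finset.prod_eq_zero (Finset.mem_univ none), mul_zero]
  simp [pi0, this]

lemma wt_option (τ : ℚ) (w : Fin 2 → ℚ) (d : Option (Fin 2) →₀ ℕ) :
    wt (fun o : Option (Fin 2) => o.elim τ w) d
      = (d none : ℚ) * τ + ∑ i, (d (some i) : ℚ) * w i := by
  simp [wt, Fintype.sum_option]

lemma lemmaE_core (w : Fin 2 → ℚ) (l : ℚ) (Z : MvPolynomial (Fin 2) k)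
    (E : MvPolynomial (Fin 2) k →ₐ[k] MvPolynomial (Option (Fin 2)) k)
    (hEZ : E Z = rename some Z) (hE0 : ∀ g, pi0 (E g) = g) (hE1 : ∃ g, E g ≠ rename some g)
    (hle : WLe w l Z) (hne : wtop w l Z ≠ 0) {a b : ℕ} (hab : Nat.Coprime a b)
    (ha : 2 ≤ a) (hb : 2 ≤ b) {c : k} (hc : c ≠ 0)
    (hdvd : (X 1 ^ a - C c * X 0 ^ b : MvPolynomial (Fin 2) k) ∣ wtop w l Z) : False := by
  classical
  -- the finite set of pairs
  let s : Finset (Σ _ : Fin 2, (Option (Fin 2) →₀ ℕ)) :=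
    (Finset.univ.sigma fun i => (E (X i)).support).filter fun x => x.2 none ≠ 0
  have hs : s.Nonempty := by
    by_contra hs
    rw [Finset.not_nonempty_iff_eq_empty] at hs
    have hX : ∀ i, E (X i) = rename some (X i) := by
      intro i
      ext d
      by_cases hd : d none = 0
      · rw [coeff_none_zero _ d hd, hE0]
      · have h2 : coeff d (rename some (X i : MvPolynomial (Fin 2) k)) = 0 := by
          by_contra h; exact hd (coeff_rename_some h)
        rw [h2]
        by_contra h
        have : (⟨i, d⟩ : Σ _ : Fin 2, (Option (Fin 2) →₀ ℕ)) ∈ s := by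
          simp [s, hd, h]
        rw [hs] at this
        simp at this
    have : E = rename some := by
      ext1 i; exact hX i
    obtain ⟨g, hg⟩ := hE1
    exact hg (by rw [this])
  obtain ⟨⟨i0, d0⟩, hmem, hmin⟩ := Finset.exists_min_image s
    (fun x => (w x.1 - ∑ j, (x.2 (some j) : ℚ) * w j) / (x.2 none : ℚ)) hs
  simp only at hmin
  set τ : ℚ := (w i0 - ∑ j, (d0 (some j) : ℚ) * w j) / (d0 none : ℚ) with hτ
  let w' : Option (Fin 2) → ℚ := fun o => o.elim τ w
  have hmem' : coeff d0 (E (X i0)) ≠ 0 ∧ d0 none ≠ 0 := by simpa [s] using hmem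
  have hrX : ∀ i, WLe w' (w i) (X (some i) : MvPolynomial (Option (Fin 2)) k) := fun i =>
    WLe.X (w := w') (some i)
  have hWE : ∀ i, WLe w' (w i) (E (X i)) := by
    intro i d hd
    by_cases h0 : d none = 0
    · rw [coeff_none_zero _ d h0, hE0, rename_X] at hd
      exact hrX i d hd
    · have h1 : (⟨i, d⟩ : Σ _ : Fin 2, (Option (Fin 2) →₀ ℕ)) ∈ s := by
        simp [s, hd, h0]
      have h2 := hmin _ h1
      have hpos : (0 : ℚ) < d none := by exact_mod_cast Nat.pos_of_ne_zero h0
      simp only at h2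
      rw [le_div_iff₀ hpos] at h2
      rw [wt_option]; linarith
  have hbar0 : wt w' d0 = w i0 := by
    have hpos : (d0 none : ℚ) ≠ 0 := by exact_mod_cast hmem'.2
    rw [wt_option, hτ]; field_simp; ring
  obtain ⟨Eb, hEbX⟩ : ∃ Eb : MvPolynomial (Fin 2) k →ₐ[k] MvPolynomial (Option (Fin 2)) k,
      ∀ i, Eb (X i) = wtop w' (w i) (E (X i)) :=
    ⟨aeval (fun i => wtop w' (w i) (E (X i))), fun i => aeval_X _ _⟩
  have hEbZ : Eb (wtop w l Z) = rename some (wtop w l Z) := by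
    have h1 := subst_top (w := w) (w' := w') E hWE hle
    have h2 := subst_top (w := w) (w' := w') (rename some)
      (fun i => by rw [rename_X]; exact hrX i) hle
    rw [hEZ, h2] at h1
    have h3 : (fun i => wtop w' (w i) (rename some (X i : MvPolynomial (Fin 2) k)))
        = fun i => X (some i) := by
      funext i
      rw [rename_X]
      exact wtop_X w' (some i)
    rw [h3] at h1
    have h4 : (aeval (fun i => X (some i)) :
        MvPolynomial (Fin 2) k →ₐ[k] MvPolynomial (Option (Fin 2)) k) = rename some := by
      ext1 i; simp
    rw [h4] at h1
    rw [h1]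
    congr 1
    ext1 i
    rw [hEbX, aeval_X]
  -- to polynomials
  obtain ⟨Θ, hΘ⟩ : ∃ Θ, Θ = optionEquivLeft k (Fin 2) := ⟨_, rfl⟩
  have hΘr : ∀ r, Θ (rename some r) = Polynomial.C r := by
    intro r
    induction r using MvPolynomial.induction_on with
    | C c => simp [hΘ]
    | add p q hp hq => simp only [map_add, hp, hq]
    | mul_X p i hp =>
      simp only [map_mul, hp, rename_X]
      congr 1
      rw [hΘ]; exact optionEquivLeft_X_some k (Fin 2) i
  have hΘ0 : ∀ g, Polynomial.eval 0 (Θ g) = pi0 g := by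
    intro g
    induction g using MvPolynomial.induction_on with
    | C c => simp [hΘ, pi0]
    | add p q hp hq => simp only [map_add, Polynomial.eval_add, hp, hq]
    | mul_X p o hp =>
      simp only [map_mul, Polynomial.eval_mul, hp]
      congr 1
      cases o with
      | none => simp [hΘ, pi0, optionEquivLeft_X_none]
      | some i => simp [hΘ, pi0, optionEquivLeft_X_some]
  have hpiEb : ∀ i, pi0 (Eb (X i)) = X i := by
    intro i
    have h1 : pi0 (Eb (X i) - X (some i)) = 0 := by
      apply pi0_eq_zero
      intro d hd h0
      apply hd
      rw [hEbX, coeff_sub, coeff_wtop, coeff_none_zero _ d h0, hE0, rename_X]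
      split_ifs with h
      · simp
      · rw [zero_sub, neg_eq_zero]
        rw [← wtop_X w' (some i), coeff_wtop, if_neg (show ¬ wt w' d = w' (some i) from h)]
    rw [map_sub, sub_eq_zero] at h1
    rw [h1]; simp [pi0]
  set A := Θ (Eb (X 1)) with hA
  set B := Θ (Eb (X 0)) with hB
  have hA0 : Polynomial.eval 0 A = X 1 := by rw [hA, hΘ0, hpiEb]
  have hB0 : Polynomial.eval 0 B = X 0 := by rw [hB, hΘ0, hpiEb]
  have hAB : Θ (Eb (X 1 ^ a - C c * X 0 ^ b)) = A ^ a - Polynomial.C (C c) * B ^ b := by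
    rw [map_sub, map_sub, map_mul, map_mul, map_pow, map_pow, map_pow, map_pow]
    congr 2
    have : Eb (C c) = C c := Eb.commutes c
    rw [this, ← rename_C some c, hΘr]
  have hdv : A ^ a - Polynomial.C (C c) * B ^ b ∣ Polynomial.C (wtop w l Z) := by
    rw [← hAB, ← hΘr, ← hEbZ]
    exact map_dvd Θ (map_dvd Eb hdvd)
  have hdeg : (A ^ a - Polynomial.C (C c) * B ^ b).natDegree = 0 := by
    have := Polynomial.natDegree_le_of_dvd hdv (by simpa using hne)
    simpa using this
  have heq : A ^ a - Polynomial.C (C c) * B ^ b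
      = Polynomial.C (X 1 ^ a - C c * X 0 ^ b) := by
    rw [Polynomial.eq_C_of_natDegree_eq_zero hdeg, Polynomial.coeff_zero_eq_eval_zero]
    simp [hA0, hB0]
  have hv : (X 1 ^ a - C c * X 0 ^ b : MvPolynomial (Fin 2) k) ≠ 0 := by
    intro h0
    rw [h0, zero_dvd_iff] at hdvd
    exact hne hdvd
  have hD : ∀ i : Fin 2, ∃ D : Derivation ℤ (MvPolynomial (Fin 2) k) (MvPolynomial (Fin 2) k),
      D (X i) = 1 ∧ ∀ c : k, D (C c) = 0 := fun i =>
    ⟨(pderiv i : Derivation k (MvPolynomial (Fin 2) k) _).restrictScalars ℤ,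
      pderiv_X_self _, fun c => pderiv_C⟩
  obtain ⟨D1, hD1X, hD1C⟩ := hD 0
  obtain ⟨D2, hD2X, hD2C⟩ := hD 1
  have h1C : ∀ D : Derivation ℤ (MvPolynomial (Fin 2) k) (MvPolynomial (Fin 2) k),
      D (C 1) = 0 → D 1 = 0 := fun D h => by rwa [C_1] at h
  have hnegC : ∀ D : Derivation ℤ (MvPolynomial (Fin 2) k) (MvPolynomial (Fin 2) k),
      D (C c) = 0 → D (- C c) = 0 := fun D h => by rw [D.map_neg, h, neg_zero]
  have hF := lemmaF D1 D2
    (c1 := 1) (c2 := - C c) (x := X 0) (y := X 1) hab ha hb one_ne_zero (by simpa using hc)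
    (X_ne_zero _) (X_ne_zero _) hD1X hD2X
    ⟨h1C _ (hD1C 1), hnegC _ (hD1C c)⟩ ⟨h1C _ (hD2C 1), hnegC _ (hD2C c)⟩ (A := A) (B := B)
    (by rw [one_mul, neg_mul, ← sub_eq_add_neg]; exact hv)
    (by
      rw [Polynomial.C_1, one_mul, one_mul, Polynomial.C_neg, neg_mul, neg_mul, ← sub_eq_add_neg,
        ← sub_eq_add_neg, heq])
  have hfin : (Θ (Eb (X i0))).natDegree = 0 := by
    fin_cases i0
    · exact hF.2
    · exact hF.1
  rw [hΘ, natDegree_optionEquivLeft] at hfin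
  have hc0 : coeff d0 (Eb (X i0)) ≠ 0 := by
    rw [hEbX, coeff_wtop, if_pos hbar0]; exact hmem'.1
  have := monomial_le_degreeOf none (mem_support_iff.2 hc0)
  omega

lemma lemmaE (φ : MvPolynomial (Fin 2) k ≃ₐ[k] MvPolynomial (Fin 2) k) (t : Fin 2)
    (w : Fin 2 → ℚ) (l : ℚ)
    (hle : WLe w l (φ.symm (X t))) (hne : wtop w l (φ.symm (X t)) ≠ 0) {a b : ℕ}
    (hab : Nat.Coprime a b)
    (ha : 2 ≤ a) (hb : 2 ≤ b) {c : k} (hc : c ≠ 0)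
    (hdvd : (X 1 ^ a - C c * X 0 ^ b : MvPolynomial (Fin 2) k) ∣ wtop w l (φ.symm (X t))) :
    False := by
  let T : MvPolynomial (Fin 2) k →ₐ[k] MvPolynomial (Option (Fin 2)) k :=
    aeval (fun i => X (some i) + if i = t then 0 else X none)
  let Ψ : MvPolynomial (Option (Fin 2)) k →ₐ[k] MvPolynomial (Option (Fin 2)) k :=
    aeval (fun o : Option (Fin 2) => o.elim (X none) (fun i => rename some (φ.symm (X i))))
  let E : MvPolynomial (Fin 2) k →ₐ[k] MvPolynomial (Option (Fin 2)) k :=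
    (Ψ.comp T).comp φ.toAlgHom
  have hEs : ∀ g, E (φ.symm g) = Ψ (T g) := by
    intro g; simp [E]
  refine lemmaE_core w l (φ.symm (X t)) E ?_ ?_ ?_ hle hne hab ha hb hc hdvd
  · rw [hEs]; simp [T, Ψ]
  · intro g
    have : (pi0.comp (Ψ.comp T)) = φ.symm.toAlgHom := by
      ext1 i
      have hpr : ∀ r : MvPolynomial (Fin 2) k, pi0 (rename some r) = r := by
        intro r
        rw [pi0, aeval_rename]; exact aeval_X_left_apply r
      by_cases h : i = t
      · simp [T, Ψ, h, hpr]
      · simp [T, Ψ, h, hpr]; simp [pi0]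
    have h2 := congrArg (fun F => F (φ g)) this
    simp only [AlgHom.comp_apply] at h2
    simpa [E] using h2
  · obtain ⟨t', ht'⟩ := exists_ne t
    refine ⟨φ.symm (X t'), ?_⟩
    rw [hEs]
    simp [T, Ψ, ht']

end LemmaE

lemma lemmaG_dvd {ι : Type*} (s : Finset ι) (h : ι → k) (κ : ι → ℕ) (N : ℕ)
    (hκ : Set.InjOn κ s) (P Q : MvPolynomial (Fin 2) k)
    (hsum : ∑ i ∈ s, C (h i) * (P ^ κ i * Q ^ (N - κ i)) = 0) (i0 : ι) (hi0 : i0 ∈ s)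
    (h0 : κ i0 = 0) (hne : h i0 ≠ 0) : P ∣ Q ^ N := by
  classical
  rw [← Finset.add_sum_erase s _ hi0, h0, pow_zero, one_mul, Nat.sub_zero] at hsum
  have h1 : P ∣ ∑ i ∈ s.erase i0, C (h i) * (P ^ κ i * Q ^ (N - κ i)) := by
    refine Finset.dvd_sum fun i hi => ?_
    rw [Finset.mem_erase] at hi
    have : κ i ≠ 0 := fun hz => hi.1 (hκ hi.2 hi0 (by rw [hz, h0]))
    exact Dvd.dvd.mul_left (Dvd.dvd.mul_right (dvd_pow_self P this) _) _
  have h2 : P ∣ C (h i0) * Q ^ N := by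
    rw [eq_neg_of_add_eq_zero_left hsum]; exact (dvd_neg).2 h1
  have h3 : Q ^ N = C (h i0)⁻¹ * (C (h i0) * Q ^ N) := by
    rw [← mul_assoc, ← C_mul, inv_mul_cancel₀ hne, C_1, one_mul]
  rw [h3]; exact h2.mul_left _

lemma lemmaG {ι : Type*} (s : Finset ι) (h : ι → k) (κ : ι → ℕ) (N : ℕ)
    (hκ : Set.InjOn κ s) (hκN : ∀ i ∈ s, κ i ≤ N) (hh : ∀ i ∈ s, h i ≠ 0)
    (P Q : MvPolynomial (Fin 2) k) (hP : P ≠ 0) (hQ : Q ≠ 0)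
    (hsum : ∑ i ∈ s, C (h i) * (P ^ κ i * Q ^ (N - κ i)) = 0) (i0 i1 : ι) (hi0 : i0 ∈ s)
    (hi1 : i1 ∈ s) (h0 : κ i0 = 0) (h1 : κ i1 = N) :
    ∃ c : k, c ≠ 0 ∧ Q = C c * P ∧ ∀ U V : MvPolynomial (Fin 2) k,
      V - C c * U ∣ ∑ i ∈ s, C (h i) * (U ^ κ i * V ^ (N - κ i)) := by
  obtain ⟨P', Q', e, hrel, rfl, rfl⟩ := UniqueFactorizationMonoid.exists_reduced_factors P hP Q
  have he : e ≠ 0 := by rintro rfl; simp at hP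
  have hsum' : ∑ i ∈ s, C (h i) * (P' ^ κ i * Q' ^ (N - κ i)) = 0 := by
    have hmul : e ^ N * ∑ i ∈ s, C (h i) * (P' ^ κ i * Q' ^ (N - κ i)) = 0 := by
      rw [← hsum, Finset.mul_sum]
      refine Finset.sum_congr rfl fun i hi => ?_
      rw [mul_pow, mul_pow]
      have : e ^ N = e ^ κ i * e ^ (N - κ i) := by
        rw [← pow_add, Nat.add_sub_cancel' (hκN i hi)]
      rw [this]; ring
    exact (mul_eq_zero.1 hmul).resolve_left (pow_ne_zero _ he)
  have d1 : P' ∣ Q' ^ N := lemmaG_dvd s h κ N hκ P' Q' hsum' i0 hi0 h0 (hh _ hi0)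
  have d2 : Q' ∣ P' ^ N := by
    refine lemmaG_dvd s h (fun i => N - κ i) N ?_ Q' P' ?_ i1 hi1 (by simp [h1]) (hh _ hi1)
    · intro a ha b hb hab
      have := hκN a ha
      have := hκN b hb
      simp only at hab
      exact hκ ha hb (by omega)
    · rw [← hsum']
      refine Finset.sum_congr rfl fun i hi => ?_
      rw [Nat.sub_sub_self (hκN i hi), mul_comm (Q' ^ _)]
  have u1 : IsUnit P' := (IsRelPrime.pow_right hrel) dvd_rfl d1
  have u2 : IsUnit Q' := (IsRelPrime.pow_right hrel.symm) dvd_rfl d2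
  rw [MvPolynomial.isUnit_iff_eq_C_of_isReduced] at u1 u2
  obtain ⟨p, hp, rfl⟩ := u1
  obtain ⟨q, hq, rfl⟩ := u2
  have hp0 := hp.ne_zero
  have hq0 := hq.ne_zero
  have hkey : ∑ i ∈ s, C (h i) * (C (q / p) : MvPolynomial (Fin 2) k) ^ (N - κ i) = 0 := by
    have hmul : (C p : MvPolynomial (Fin 2) k) ^ N *
        ∑ i ∈ s, C (h i) * (C (q / p) : MvPolynomial (Fin 2) k) ^ (N - κ i) = 0 := by
      rw [← hsum', Finset.mul_sum]
      refine Finset.sum_congr rfl fun i hi => ?_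
      have : (C p : MvPolynomial (Fin 2) k) ^ N = C p ^ κ i * C p ^ (N - κ i) := by
        rw [← pow_add, Nat.add_sub_cancel' (hκN i hi)]
      have h2 : (C q : MvPolynomial (Fin 2) k) = C p * C (q / p) := by
        rw [← C_mul]; congr 1; field_simp
      rw [this, h2, mul_pow]; ring
    refine (mul_eq_zero.1 hmul).resolve_left (pow_ne_zero _ ?_)
    simpa using hp0
  refine ⟨q / p, div_ne_zero hq0 hp0, ?_, ?_⟩
  · have h2 : (C q : MvPolynomial (Fin 2) k) = C p * C (q / p) := by
      rw [← C_mul]; congr 1; field_simp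
    rw [h2]; ring
  · intro U V
    have : ∑ i ∈ s, C (h i) * (U ^ κ i * V ^ (N - κ i)) =
        ∑ i ∈ s, C (h i) * U ^ κ i * (V ^ (N - κ i) - (C (q / p) * U) ^ (N - κ i)) := by
      rw [← sub_eq_zero, ← Finset.sum_sub_distrib, ← mul_zero (U ^ N), ← hkey, Finset.mul_sum]
      refine Finset.sum_congr rfl fun i hi => ?_
      have : U ^ N = U ^ κ i * U ^ (N - κ i) := by
        rw [← pow_add, Nat.add_sub_cancel' (hκN i hi)]
      rw [this, mul_pow]; ring
    rw [this]
    exact Finset.dvd_sum fun i _ => (sub_dvd_pow_sub_pow _ _ _).mul_left _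

lemma finsupp2_ext {d e : Fin 2 →₀ ℕ} (h0 : d 0 = e 0) (h1 : d 1 = e 1) : d = e := by
  ext i; fin_cases i
  · exact h0
  · exact h1

lemma aeval_eq_sum2 (P Q : MvPolynomial (Fin 2) k) (H : MvPolynomial (Fin 2) k) :
    aeval ![P, Q] H = ∑ d ∈ H.support, C (coeff d H) * (P ^ d 0 * Q ^ d 1) := by
  conv_lhs => rw [H.as_sum, map_sum]
  refine Finset.sum_congr rfl fun d _ => ?_
  rw [monomial_subst, Fin.prod_univ_two]
  simp

lemma lemmaG2 {r s : ℕ} (hr : 0 < r) (hs : 0 < s) (hrs : Nat.Coprime r s)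
    {H : MvPolynomial (Fin 2) k} (hH : H ≠ 0)
    (hhom : ∀ d e, coeff d H ≠ 0 → coeff e H ≠ 0 → r * d 0 + s * d 1 = r * e 0 + s * e 1)
    {P Q : MvPolynomial (Fin 2) k} (hP : P ≠ 0) (hQ : Q ≠ 0) (h0 : aeval ![P, Q] H = 0) :
    ∃ c : k, c ≠ 0 ∧ Q ^ r = C c * P ^ s ∧ (X 1 ^ r - C c * X 0 ^ s) ∣ H := by
  classical
  have hne : H.support.Nonempty := by
    rw [Finset.nonempty_iff_ne_empty]; simpa using hH
  obtain ⟨a, ha, hamin⟩ := Finset.exists_min_image H.support (fun d => d 0) hne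
  obtain ⟨b, hb, hbmax⟩ := Finset.exists_max_image H.support (fun d => d 0) hne
  have hdiv : ∀ d ∈ H.support, ∃ κ, d 0 = a 0 + s * κ := by
    intro d hd
    have h1 := hhom d a (by simpa using hd) (by simpa using ha)
    have h2 := hamin d hd
    have h3 : s ∣ r * (d 0 - a 0) := by
      refine ⟨a 1 - d 1, ?_⟩
      have h4 : d 1 ≤ a 1 := by
        by_contra h
        nlinarith
      zify [h2, h4] at h1 ⊢
      linarith
    have h5 : s ∣ d 0 - a 0 := (hrs.symm.dvd_mul_left).1 h3
    obtain ⟨κ, hκ⟩ := h5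
    exact ⟨κ, by omega⟩
  choose! κ hκ using hdiv
  set N := κ b with hN
  have hκN : ∀ d ∈ H.support, κ d ≤ N := by
    intro d hd
    have h1 := hbmax d hd
    rw [hκ d hd, hκ b hb] at h1
    have : s * κ d ≤ s * κ b := by omega
    exact Nat.le_of_mul_le_mul_left this hs
  have hy : ∀ d ∈ H.support, d 1 = b 1 + r * (N - κ d) := by
    intro d hd
    have h1 := hhom d b (by simpa using hd) (by simpa using hb)
    have h2 := hκN d hd
    rw [hκ d hd, hκ b hb] at h1
    obtain ⟨t, ht⟩ := Nat.exists_eq_add_of_le h2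
    rw [← hN, ht] at h1
    rw [ht, Nat.add_sub_cancel_left]
    have : s * d 1 = s * (b 1 + r * t) := by nlinarith
    exact Nat.eq_of_mul_eq_mul_left hs this
  have hfac : ∀ U V : MvPolynomial (Fin 2) k, aeval ![U, V] H = U ^ a 0 * V ^ b 1 *
      ∑ d ∈ H.support, C (coeff d H) * ((U ^ s) ^ κ d * (V ^ r) ^ (N - κ d)) := by
    intro U V
    rw [aeval_eq_sum2, Finset.mul_sum]
    refine Finset.sum_congr rfl fun d hd => ?_
    rw [hκ d hd, hy d hd, pow_add, pow_add, pow_mul, pow_mul]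
    ring
  rw [hfac] at h0
  have h0' := (mul_eq_zero.1 h0).resolve_left (mul_ne_zero (pow_ne_zero _ hP) (pow_ne_zero _ hQ))
  have ha0 : κ a = 0 := by
    have := hκ a ha
    have h2 : s * κ a = 0 := by omega
    rcases Nat.mul_eq_zero.1 h2 with h | h
    · omega
    · exact h
  obtain ⟨c, hc, hc1, hc2⟩ := lemmaG H.support (fun d => coeff d H) κ N
    (by
      intro d hd e he hde
      exact finsupp2_ext (by rw [hκ d hd, hκ e he, hde]) (by rw [hy d hd, hy e he, hde]))
    hκN (fun d hd => by simpa using hd) (P ^ s) (Q ^ r) (pow_ne_zero _ hP) (pow_ne_zero _ hQ)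
    h0' a b ha hb ha0 rfl
  refine ⟨c, hc, hc1, ?_⟩
  have hX : aeval ![X 0, X 1] H = H := by
    have : (![X 0, X 1] : Fin 2 → MvPolynomial (Fin 2) k) = X := by
      funext i; fin_cases i <;> rfl
    rw [this]; exact aeval_X_left_apply H
  rw [← hX, hfac]
  exact (hc2 _ _).mul_left _

/-- unit weights -/
def w1 : Fin 2 → ℚ := fun _ => 1

lemma wt_w1 (d : Fin 2 →₀ ℕ) : wt w1 d = ((d 0 + d 1 : ℕ) : ℚ) := by
  simp [wt, w1, Fin.sum_univ_two]

lemma wt_two (w : Fin 2 → ℚ) (d : Fin 2 →₀ ℕ) : wt w d = d 0 * w 0 + d 1 * w 1 := by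
  simp [wt, Fin.sum_univ_two]

lemma td_le_iff (g : MvPolynomial (Fin 2) k) (n : ℕ) : g.totalDegree ≤ n ↔ WLe w1 n g := by
  have hdeg : ∀ d : Fin 2 →₀ ℕ, (d.sum fun _ e => e) = d 0 + d 1 := by
    intro d
    rw [Finsupp.sum_fintype _ _ (by simp), Fin.sum_univ_two]
  constructor
  · intro h d hd
    have := le_totalDegree (mem_support_iff.2 hd)
    rw [hdeg] at this
    rw [wt_w1]
    exact_mod_cast this.trans h
  · intro h
    rw [totalDegree, Finset.sup_le_iff]
    intro d hd
    have := h d (mem_support_iff.1 hd)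
    rw [wt_w1] at this
    rw [hdeg]
    exact_mod_cast this

lemma td_lt_of_wtop {g : MvPolynomial (Fin 2) k} {n : ℕ} (hn : 1 ≤ n) (h : g.totalDegree ≤ n)
    (h0 : wtop w1 n g = 0) : g.totalDegree < n := by
  have : g.totalDegree ≤ n - 1 := by
    rw [td_le_iff] at h ⊢
    intro d hd
    have h1 := h d hd
    have h2 : wt w1 d ≠ n := by
      intro h2
      have := congrArg (coeff d) h0
      rw [coeff_wtop, if_pos h2] at this
      exact hd (by simpa using this)
    rw [wt_w1] at h1 h2 ⊢
    norm_cast at h1 h2 ⊢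
    omega
  omega

lemma wtop_td_ne {g : MvPolynomial (Fin 2) k} (h0 : g ≠ 0) : wtop w1 g.totalDegree g ≠ 0 := by
  obtain ⟨l, hl, hne, d, hd, hdl⟩ := exists_wtop w1 h0
  rw [← hdl, wt_w1] at hl hne
  have h1 := (td_le_iff g _).2 hl
  have h2 := (td_le_iff g _).1 le_rfl d hd
  rw [wt_w1] at h2
  norm_cast at h2
  rwa [le_antisymm h1 h2]

lemma td_pos (φ : MvPolynomial (Fin 2) k ≃ₐ[k] MvPolynomial (Fin 2) k) (i : Fin 2) :
    1 ≤ (φ (X i)).totalDegree := by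
  by_contra h
  have h0 : (φ (X i)).totalDegree = 0 := by omega
  rw [totalDegree_eq_zero_iff_eq_C] at h0
  have h1 : φ (X i) = φ (C (coeff 0 (φ (X i)))) := by
    conv_lhs => rw [h0]
    exact (φ.commutes _).symm
  have h2 := φ.injective h1
  have := congrArg totalDegree h2
  simp at this

lemma phi_ne (φ : MvPolynomial (Fin 2) k ≃ₐ[k] MvPolynomial (Fin 2) k) (i : Fin 2) :
    φ (X i) ≠ 0 := by
  intro h
  have := td_pos φ i
  rw [h] at this; simp at this

lemma lemmaJ1 (φ : MvPolynomial (Fin 2) k ≃ₐ[k] MvPolynomial (Fin 2) k)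
    (hmn : (φ (X 1)).totalDegree ≤ (φ (X 0)).totalDegree) :
    (∀ i, WLe (fun j => ((φ (X j)).totalDegree : ℚ)) 1 (φ.symm (X i))) ∨
    ∃ (c : k) (r : ℕ), c ≠ 0 ∧ 1 ≤ r ∧ (φ (X 0)).totalDegree = r * (φ (X 1)).totalDegree ∧
      (φ (X 0) - C c * φ (X 1) ^ r).totalDegree < (φ (X 0)).totalDegree := by
  by_cases hall : ∀ i, WLe (fun j => ((φ (X j)).totalDegree : ℚ)) 1 (φ.symm (X i))
  · exact Or.inl hall
  right
  push Not at hall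
  obtain ⟨i, hi⟩ := hall
  set w : Fin 2 → ℚ := fun j => ((φ (X j)).totalDegree : ℚ) with hw
  set Z := φ.symm (X i) with hZ
  have hZ0 : Z ≠ 0 := phi_ne φ.symm i
  obtain ⟨l, hl, hne, -⟩ := exists_wtop w hZ0
  have hl1 : 1 < l := by
    by_contra h
    exact hi (hl.mono (not_lt.1 h))
  have hΦ : ∀ j, WLe w1 (w j) (φ.toAlgHom (X j)) := fun j => (td_le_iff _ _).1 le_rfl
  have htop := subst_top φ.toAlgHom hΦ hl
  have hφZ : φ.toAlgHom Z = X i := by simp [hZ]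
  have hX1 : WLe w1 1 (X i : MvPolynomial (Fin 2) k) := WLe.X (w := w1) i
  rw [hφZ, wtop_eq_zero hX1 hl1] at htop
  set P := wtop w1 (φ (X 0)).totalDegree (φ (X 0)) with hPdef
  set Q := wtop w1 (φ (X 1)).totalDegree (φ (X 1)) with hQdef
  have hPQ : (fun j => wtop w1 (w j) (φ.toAlgHom (X j))) = ![P, Q] := by
    funext j; fin_cases j <;> rfl
  rw [hPQ] at htop
  set m := (φ (X 0)).totalDegree with hm
  set n := (φ (X 1)).totalDegree with hn
  have hn1 : 1 ≤ n := td_pos φ 1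
  have hm1 : 1 ≤ m := td_pos φ 0
  obtain ⟨g, r, s, hg, hrs, hmr, hns⟩ := Nat.exists_coprime' (m := m) (n := n)
    (Nat.gcd_pos_of_pos_left _ hm1)
  have hr : 0 < r := by
    rcases Nat.eq_zero_or_pos r with h | h
    · rw [h] at hmr; omega
    · exact h
  have hs : 0 < s := by
    rcases Nat.eq_zero_or_pos s with h | h
    · rw [h] at hns; omega
    · exact h
  have hsr : s ≤ r := by
    rw [hmr, hns] at hmn
    exact Nat.le_of_mul_le_mul_right hmn hg
  have hhom : ∀ d e, coeff d (wtop w l Z) ≠ 0 → coeff e (wtop w l Z) ≠ 0 →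
      r * d 0 + s * d 1 = r * e 0 + s * e 1 := by
    intro d e hd he
    rw [coeff_wtop] at hd he
    have h1 : wt w d = l := by by_contra h; simp [h] at hd
    have h2 : wt w e = l := by by_contra h; simp [h] at he
    rw [wt_two] at h1 h2
    have h3 : (d 0 * m + d 1 * n : ℚ) = e 0 * m + e 1 * n := h1.trans h2.symm
    have h4 : d 0 * m + d 1 * n = e 0 * m + e 1 * n := by exact_mod_cast h3
    rw [hmr, hns] at h4
    refine Nat.eq_of_mul_eq_mul_right hg ?_
    linarith
  have hP0 : P ≠ 0 := wtop_td_ne (phi_ne φ 0)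
  have hQ0 : Q ≠ 0 := wtop_td_ne (phi_ne φ 1)
  obtain ⟨c, hc, hQP, hdvd⟩ := lemmaG2 hr hs hrs hne hhom hP0 hQ0 htop.symm
  have hs1 : s = 1 := by
    by_contra h
    exact lemmaE φ i w l hl hne hrs (by omega) (by omega) hc hdvd
  subst hs1
  have hmr' : m = r * n := by rw [hmr, hns]; ring
  refine ⟨c⁻¹, r, inv_ne_zero hc, hr, hmr', ?_⟩
  have hle1 : WLe w1 (m : ℚ) (φ (X 0)) := (td_le_iff _ _).1 le_rfl
  have hle2 : WLe w1 (n : ℚ) (φ (X 1)) := (td_le_iff _ _).1 le_rfl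
  have hle3 : WLe w1 (0 + (r : ℚ) * n) (C c⁻¹ * φ (X 1) ^ r) := (WLe.C _).mul (hle2.pow r)
  have heq : (m : ℚ) = 0 + (r : ℚ) * n := by rw [hmr']; push_cast; ring
  refine td_lt_of_wtop hm1 ((td_le_iff _ _).2 (hle1.sub (heq ▸ hle3))) ?_
  rw [wtop_sub]
  rw [sub_eq_zero]
  conv_rhs => rw [heq]
  rw [wtop_mul (WLe.C _) (hle2.pow r), wtop_pow hle2, wtop_C]
  change P = C c⁻¹ * Q ^ r
  rw [hQP, pow_one, ← mul_assoc, ← C_mul, inv_mul_cancel₀ hc, C_1, one_mul]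

/-- elementary automorphism `x ↦ x + P(y)` -/
noncomputable def el (P : Polynomial k) :
    MvPolynomial (Fin 2) k ≃ₐ[k] MvPolynomial (Fin 2) k :=
  AlgEquiv.ofAlgHom (aeval ![X 0 + Polynomial.aeval (X 1) P, X 1])
    (aeval ![X 0 - Polynomial.aeval (X 1) P, X 1])
    (by
      ext1 i
      fin_cases i
      · simp [← Polynomial.aeval_algHom_apply]
      · simp)
    (by
      ext1 i
      fin_cases i
      · simp [← Polynomial.aeval_algHom_apply]
      · simp)

lemma el_X0 (P : Polynomial k) : el P (X 0) = X 0 + Polynomial.aeval (X 1) P := by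
  simp [el]

lemma el_X1 (P : Polynomial k) : el P (X 1) = X 1 := by
  simp [el]

lemma el_symm_X0 (P : Polynomial k) : (el P).symm (X 0) = X 0 - Polynomial.aeval (X 1) P := by
  simp [el]

lemma el_symm_X1 (P : Polynomial k) : (el P).symm (X 1) = X 1 := by
  simp [el]

lemma el_symm_trans_X0 (P : Polynomial k)
    (φ : MvPolynomial (Fin 2) k ≃ₐ[k] MvPolynomial (Fin 2) k) :
    ((el P).symm.trans φ) (X 0) = φ (X 0) - Polynomial.aeval (φ (X 1)) P := by
  rw [AlgEquiv.trans_apply, el_symm_X0, map_sub]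
  congr 1
  exact (Polynomial.aeval_algHom_apply φ.toAlgHom (X 1) P).symm

lemma el_symm_trans_X1 (P : Polynomial k)
    (φ : MvPolynomial (Fin 2) k ≃ₐ[k] MvPolynomial (Fin 2) k) :
    ((el P).symm.trans φ) (X 1) = φ (X 1) := by
  rw [AlgEquiv.trans_apply, el_symm_X1]

/-- swap of variables -/
noncomputable def sw : MvPolynomial (Fin 2) k ≃ₐ[k] MvPolynomial (Fin 2) k :=
  renameEquiv k (Equiv.swap 0 1)

lemma sw_X0 : (sw (X 0) : MvPolynomial (Fin 2) k) = X 1 := by simp [sw]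
lemma sw_X1 : (sw (X 1) : MvPolynomial (Fin 2) k) = X 0 := by simp [sw]
lemma sw_sw (f : MvPolynomial (Fin 2) k) : sw (sw f) = f := by
  simp [sw, rename_rename, ← Equiv.coe_trans]

lemma WLe_aeval {w : Fin 2 → ℚ} {l : ℚ} (hl : 0 ≤ l) {q : MvPolynomial (Fin 2) k} (hq : WLe w l q)
    (P : Polynomial k) : WLe w (P.natDegree * l) (Polynomial.aeval q P) := by
  rw [Polynomial.aeval_eq_sum_range]
  refine WLe.sum _ _ fun i hi => ?_
  rw [smul_eq_C_mul, ← zero_add ((P.natDegree : ℚ) * l)]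
  refine (WLe.C _).mul ((hq.pow i).mono ?_)
  have : (i : ℚ) ≤ P.natDegree := by
    exact_mod_cast Nat.lt_succ_iff.1 (Finset.mem_range.1 hi)
  exact mul_le_mul_of_nonneg_right this hl

lemma td_aeval (q : MvPolynomial (Fin 2) k) (P : Polynomial k) :
    (Polynomial.aeval q P).totalDegree ≤ P.natDegree * q.totalDegree := by
  rw [td_le_iff]
  push_cast
  exact WLe_aeval (by positivity) ((td_le_iff _ _).1 le_rfl) P

lemma J1_ge2 (φ : MvPolynomial (Fin 2) k ≃ₐ[k] MvPolynomial (Fin 2) k)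
    (hmn : (φ (X 1)).totalDegree ≤ (φ (X 0)).totalDegree) (h2 : 2 ≤ (φ (X 0)).totalDegree) :
    ∃ (c : k) (r : ℕ), c ≠ 0 ∧ 1 ≤ r ∧ (φ (X 0)).totalDegree = r * (φ (X 1)).totalDegree ∧
      (φ (X 0) - C c * φ (X 1) ^ r).totalDegree < (φ (X 0)).totalDegree := by
  refine (lemmaJ1 φ hmn).resolve_left fun h => ?_
  have h1 := td_pos φ 1
  have hW : ∀ i, WLe ![1, 0] ((fun _ => 0 : Fin 2 → ℚ) i) (φ.symm.toAlgHom (X i)) := by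
    intro i d hd
    have h3 := h i d hd
    rw [wt_two] at h3 ⊢
    have h4 : d 0 * (φ (X 0)).totalDegree + d 1 * (φ (X 1)).totalDegree ≤ 1 := by
      exact_mod_cast h3
    have h5 : d 0 = 0 := by
      by_contra h
      have := Nat.pos_of_ne_zero h
      nlinarith
    simp [h5]
  have h6 := subst_le φ.symm.toAlgHom hW (l := 0) (g := φ (X 0))
    (by intro d _; rw [wt_two]; simp)
  have h7 : φ.symm.toAlgHom (φ (X 0)) = X 0 := by simp
  rw [h7] at h6
  have h8 := h6 (Finsupp.single 0 1) (by simp)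
  rw [wt_two] at h8
  simp at h8
  norm_num at h8

lemma aff_td_le (φ : MvPolynomial (Fin 2) k ≃ₐ[k] MvPolynomial (Fin 2) k)
    (h0 : (φ (X 0)).totalDegree ≤ 1) (h1 : (φ (X 1)).totalDegree ≤ 1) (f : MvPolynomial (Fin 2) k) :
    f.totalDegree ≤ (φ f).totalDegree := by
  have e0 := td_pos φ 0
  have e1 := td_pos φ 1
  have h0' : (φ (X 0)).totalDegree = 1 := by omega
  have h1' : (φ (X 1)).totalDegree = 1 := by omega
  rcases lemmaJ1 φ (by omega) with h | ⟨c, r, hc, hr, hrr, hlt⟩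
  · have hw : (fun j => ((φ (X j)).totalDegree : ℚ)) = w1 := by
      funext j; fin_cases j
      · simp [h0', w1]
      · simp [h1', w1]
    rw [hw] at h
    have := subst_le (w := w1) (w' := w1) φ.symm.toAlgHom (fun i => h i)
      ((td_le_iff (φ f) _).1 le_rfl)
    have e : φ.symm.toAlgHom (φ f) = f := by simp
    rw [e] at this
    exact (td_le_iff _ _).2 this
  · exfalso
    have := td_pos ((el (Polynomial.C c * Polynomial.X ^ r)).symm.trans φ) 0
    rw [el_symm_trans_X0] at this
    simp only [map_mul, Polynomial.aeval_C, map_pow, Polynomial.aeval_X] at this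
    rw [h0'] at hlt
    change 1 ≤ (φ (X 0) - C c * φ (X 1) ^ r).totalDegree at this
    omega

lemma lemmaJ2_aux (n : ℕ) : ∀ φ : MvPolynomial (Fin 2) k ≃ₐ[k] MvPolynomial (Fin 2) k,
    (φ (X 0)).totalDegree ≤ n →
    ∃ P : Polynomial k, P.natDegree * (φ (X 1)).totalDegree ≤ (φ (X 0)).totalDegree ∧
    ((φ (X 0) - Polynomial.aeval (φ (X 1)) P).totalDegree < (φ (X 1)).totalDegree ∨
      ((φ (X 1)).totalDegree = 1 ∧ (φ (X 0) - Polynomial.aeval (φ (X 1)) P).totalDegree ≤ 1)) := by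
  induction n with
  | zero => intro φ h; have := td_pos φ 0; omega
  | succ n ih =>
    intro φ hn
    have e0 := td_pos φ 0
    have e1 := td_pos φ 1
    by_cases hlt : (φ (X 0)).totalDegree < (φ (X 1)).totalDegree
    · exact ⟨0, by simp, Or.inl (by simpa using hlt)⟩
    by_cases h1 : (φ (X 0)).totalDegree ≤ 1
    · exact ⟨0, by simp, Or.inr ⟨by omega, by simpa using h1⟩⟩
    obtain ⟨c, r, hc, hr, hrr, hl⟩ := J1_ge2 φ (by omega) (by omega)
    have k0 : ((el (Polynomial.C c * Polynomial.X ^ r)).symm.trans φ) (X 0)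
        = φ (X 0) - C c * φ (X 1) ^ r := by
      rw [el_symm_trans_X0]
      simp only [map_mul, Polynomial.aeval_C, map_pow, Polynomial.aeval_X]
      rfl
    have k1 := el_symm_trans_X1 (Polynomial.C c * Polynomial.X ^ r) φ
    obtain ⟨P, hP1, hP2⟩ := ih ((el (Polynomial.C c * Polynomial.X ^ r)).symm.trans φ)
      (by rw [k0]; omega)
    rw [k0, k1] at hP1 hP2
    refine ⟨P + Polynomial.C c * Polynomial.X ^ r, ?_, ?_⟩
    · have hd := Polynomial.natDegree_add_le P (Polynomial.C c * Polynomial.X ^ r)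
      rw [Polynomial.natDegree_C_mul_X_pow r c hc] at hd
      rcases le_max_iff.1 hd with h | h
      · exact (Nat.mul_le_mul_right _ h).trans (by omega)
      · exact (Nat.mul_le_mul_right _ h).trans (by omega)
    · have : φ (X 0) - Polynomial.aeval (φ (X 1)) (P + Polynomial.C c * Polynomial.X ^ r)
          = φ (X 0) - C c * φ (X 1) ^ r - Polynomial.aeval (φ (X 1)) P := by
        simp only [map_add, map_mul, Polynomial.aeval_C, map_pow, Polynomial.aeval_X]
        change _ - (_ + C c * _) = _
        ring
      rw [this]; exact hP2

lemma lemmaJ2 (φ : MvPolynomial (Fin 2) k ≃ₐ[k] MvPolynomial (Fin 2) k)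
    (hlt : (φ (X 1)).totalDegree < (φ (X 0)).totalDegree) :
    ∃ P : Polynomial k, (φ (X 0)).totalDegree = P.natDegree * (φ (X 1)).totalDegree ∧
    2 ≤ P.natDegree ∧
    ((φ (X 0) - Polynomial.aeval (φ (X 1)) P).totalDegree < (φ (X 1)).totalDegree ∨
      ((φ (X 1)).totalDegree = 1 ∧ (φ (X 0) - Polynomial.aeval (φ (X 1)) P).totalDegree ≤ 1)) := by
  obtain ⟨P, hP1, hP2⟩ := lemmaJ2_aux _ φ le_rfl
  have h1 := td_aeval (φ (X 1)) P
  have h2 : (φ (X 0)).totalDegree ≤ max (φ (X 0) - Polynomial.aeval (φ (X 1)) P).totalDegree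
      (Polynomial.aeval (φ (X 1)) P).totalDegree := by
    conv_lhs => rw [← sub_add_cancel (φ (X 0)) (Polynomial.aeval (φ (X 1)) P)]
    exact totalDegree_add _ _
  have h3 : (φ (X 0)).totalDegree ≤ P.natDegree * (φ (X 1)).totalDegree := by
    rcases le_max_iff.1 h2 with h | h
    · rcases hP2 with h' | ⟨h', h''⟩ <;> omega
    · omega
  refine ⟨P, by omega, ?_, hP2⟩
  by_contra hc
  have : P.natDegree ≤ 1 := by omega
  nlinarith

lemma exists_degreeOf {f : MvPolynomial (Fin 2) k} (hf : f ≠ 0) (i : Fin 2) :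
    ∃ d, coeff d f ≠ 0 ∧ d i = degreeOf i f := by
  have hne : f.support.Nonempty := by
    rw [Finset.nonempty_iff_ne_empty]; simpa using hf
  obtain ⟨d, hd, hmax⟩ := Finset.exists_max_image f.support (fun d => d i) hne
  refine ⟨d, by simpa using hd, le_antisymm (monomial_le_degreeOf i hd) ?_⟩
  rw [degreeOf_le_iff]
  exact hmax

lemma X_pow_dvd' {g : MvPolynomial (Fin 2) k} {a : ℕ} (h : ∀ d, coeff d g ≠ 0 → a ≤ d 0) :
    (X 0 : MvPolynomial (Fin 2) k) ^ a ∣ g := by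
  rw [g.as_sum]
  refine Finset.dvd_sum fun d hd => ?_
  have h1 := h d (by simpa using hd)
  refine ⟨monomial (d - Finsupp.single 0 a) (coeff d g), ?_⟩
  rw [X_pow_eq_monomial, monomial_mul, one_mul, add_tsub_cancel_of_le]
  rw [Finsupp.single_le_iff]; exact h1

lemma wtop_wtop {w : Fin 2 → ℚ} {l : ℚ} (f : MvPolynomial (Fin 2) k) (d : Fin 2 →₀ ℕ)
    (hd : coeff d (wtop w l f) ≠ 0) : wt w d = l ∧ coeff d f ≠ 0 := by
  rw [coeff_wtop] at hd
  split_ifs at hd with h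
  · exact ⟨h, hd⟩
  · simp at hd

lemma el_wtop (P : Polynomial k) {w : Fin 2 → ℚ} (hw0 : w 0 = P.natDegree) (hw1 : w 1 = 1) :
    (∀ i, WLe w (w i) (el P (X i))) ∧
    ∀ i, wtop w (w i) (el P (X i))
      = el (Polynomial.C P.leadingCoeff * Polynomial.X ^ P.natDegree) (X i) := by
  have hX1 : WLe w 1 (X 1 : MvPolynomial (Fin 2) k) := hw1 ▸ WLe.X (w := w) 1
  have hP := WLe_aeval (zero_le_one) hX1 P
  rw [mul_one, ← hw0] at hP
  constructor
  · intro i; fin_cases i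
    · change WLe w (w 0) (el P (X 0))
      rw [el_X0]
      exact (WLe.X (w := w) 0).add hP
    · change WLe w (w 1) (el P (X 1))
      rw [el_X1]; exact WLe.X (w := w) 1
  · intro i; fin_cases i
    · change wtop w (w 0) (el P (X 0)) = el _ (X 0)
      rw [el_X0, el_X0, wtop_add, wtop_X]
      congr 1
      rw [Polynomial.aeval_eq_sum_range, wtop_sum, Finset.sum_range_succ]
      rw [Finset.sum_eq_zero, zero_add]
      · rw [smul_eq_C_mul, ← zero_add (w 0), hw0, ← mul_one (P.natDegree : ℚ),
          wtop_mul (WLe.C _) (hX1.pow _), wtop_C, wtop_pow hX1]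
        have := wtop_X (k := k) w 1
        rw [hw1] at this
        rw [this]
        simp only [map_mul, Polynomial.aeval_C, map_pow, Polynomial.aeval_X]
        rfl
      · intro j hj
        rw [smul_eq_C_mul]
        refine wtop_eq_zero ((WLe.C _).mul (hX1.pow j)) ?_
        rw [hw0, mul_one, zero_add]
        exact_mod_cast Finset.mem_range.1 hj
    · change wtop w (w 1) (el P (X 1)) = el _ (X 1)
      rw [el_X1, el_X1, wtop_X]

lemma lemmaS_core (P : Polynomial k) (hs : 1 ≤ P.natDegree) {f : MvPolynomial (Fin 2) k}
    (hf : f ≠ 0) : ∃ da db : Fin 2 →₀ ℕ, coeff da f ≠ 0 ∧ coeff db (el P f) ≠ 0 ∧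
      P.natDegree * da 0 + da 1 = P.natDegree * db 0 + db 1 ∧
      P.natDegree * (da 0 + db 0) ≤ P.natDegree * da 0 + da 1 ∧
      ∀ d, coeff d f ≠ 0 → P.natDegree * d 0 + d 1 ≤ P.natDegree * da 0 + da 1 := by
  set s := P.natDegree with hsdef
  set c := P.leadingCoeff with hc
  have hc0 : c ≠ 0 := by
    rw [hc, Polynomial.leadingCoeff_ne_zero]
    rintro rfl; simp at hsdef; omega
  let w : Fin 2 → ℚ := ![(s : ℚ), 1]
  have hw0 : w 0 = s := rfl
  have hw1 : w 1 = 1 := rfl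
  have hwt : ∀ d, wt w d = ((s * d 0 + d 1 : ℕ) : ℚ) := by
    intro d; rw [wt_two, hw0, hw1]; push_cast; ring
  obtain ⟨l, hl, hne, d0, hd0, hd0l⟩ := exists_wtop w hf
  obtain ⟨hE1, hE2⟩ := el_wtop P hw0 hw1
  have htop := subst_top (w := w) (w' := w) (el P).toAlgHom hE1 hl
  set e := el (Polynomial.C c * Polynomial.X ^ s) with he
  have htop' : wtop w l (el P f) = e (wtop w l f) := by
    have h1 : (fun i => wtop w (w i) ((el P).toAlgHom (X i))) = fun i => e (X i) :=
      funext fun i => hE2 i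
    rw [h1] at htop
    have h2 : (aeval fun i => e (X i)) = e.toAlgHom := by
      ext1 i; simp
    rw [h2] at htop
    exact htop
  set fw := wtop w l f with hfw
  have hne' : wtop w l (el P f) ≠ 0 := by
    rw [htop']; simpa using hne
  have hmin : ∀ g : MvPolynomial (Fin 2) k, g ≠ 0 →
      ∃ d, coeff d g ≠ 0 ∧ X 0 ^ d 0 ∣ g := by
    intro g hg
    have hn : g.support.Nonempty := by
      rw [Finset.nonempty_iff_ne_empty]; simpa using hg
    obtain ⟨d, hd, hmin⟩ := Finset.exists_min_image g.support (fun d => d 0) hn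
    exact ⟨d, by simpa using hd, X_pow_dvd' fun e he => hmin e (by simpa using he)⟩
  obtain ⟨da, hda, hdvda⟩ := hmin fw hne
  obtain ⟨db, hdb, hdvdb⟩ := hmin _ hne'
  obtain ⟨ha1, ha2⟩ := wtop_wtop _ _ hda
  obtain ⟨hb1, hb2⟩ := wtop_wtop _ _ hdb
  refine ⟨da, db, ha2, hb2, ?_, ?_, ?_⟩
  · have := ha1.trans hb1.symm
    rw [hwt, hwt] at this
    exact_mod_cast this
  · -- divisibility
    have hU : e.symm (X 0) = X 0 - C c * X 1 ^ s := by
      rw [he, el_symm_X0]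
      simp only [map_mul, Polynomial.aeval_C, map_pow, Polynomial.aeval_X]
      rfl
    set U : MvPolynomial (Fin 2) k := X 0 - C c * X 1 ^ s with hUdef
    have hdvdb' : U ^ db 0 ∣ fw := by
      rw [htop'] at hdvdb
      have := map_dvd e.symm hdvdb
      rwa [map_pow, hU, AlgEquiv.symm_apply_apply] at this
    have hrel : IsRelPrime (X 0 : MvPolynomial (Fin 2) k) U := by
      rw [(X_prime (R := k) (i := (0 : Fin 2))).irreducible.isRelPrime_iff_not_dvd]
      intro h
      have := map_dvd (aeval ![(0 : k), 1]) h
      simp [hUdef] at this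
      exact hc0 this
    have hdvd : X 0 ^ da 0 * U ^ db 0 ∣ fw := (hrel.pow).mul_dvd hdvda hdvdb'
    obtain ⟨h, hh⟩ := hdvd
    have hh0 : h ≠ 0 := by rintro rfl; rw [mul_zero] at hh; exact hne hh
    obtain ⟨lh, hlh, hneh, dh, -, hdh⟩ := exists_wtop w hh0
    have hlh0 : 0 ≤ lh := by rw [← hdh, hwt]; positivity
    have hX0 : WLe w s (X 0 : MvPolynomial (Fin 2) k) := WLe.X (w := w) 0
    have hX1 : WLe w 1 (X 1 : MvPolynomial (Fin 2) k) := WLe.X (w := w) 1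
    have hUW : WLe w s U := by
      refine hX0.sub ?_
      have := (WLe.C (w := w) c).mul (hX1.pow s)
      simpa using this
    have htX0 : wtop w s (X 0 : MvPolynomial (Fin 2) k) = X 0 := wtop_X w 0
    have htX1 : wtop w 1 (X 1 : MvPolynomial (Fin 2) k) = X 1 := wtop_X w 1
    have htU : wtop w s U = U := by
      rw [hUdef, wtop_sub, htX0]
      congr 1
      have := wtop_mul (WLe.C (w := w) c) (hX1.pow s)
      rw [wtop_C, wtop_pow hX1, htX1] at this
      simpa using this
    have hprod := wtop_mul ((hX0.pow (da 0)).mul (hUW.pow (db 0))) hlh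
    rw [wtop_mul (hX0.pow (da 0)) (hUW.pow (db 0)), wtop_pow hX0, wtop_pow hUW, htX0, htU,
      ← hh] at hprod
    have hU0 : U ≠ 0 := by
      intro h
      rw [h] at hU
      simp at hU
    have hnz : wtop w (da 0 * s + db 0 * s + lh) fw ≠ 0 := by
      rw [hprod]
      exact mul_ne_zero (mul_ne_zero (pow_ne_zero _ (X_ne_zero _)) (pow_ne_zero _ hU0)) hneh
    have hfl : WLe w l fw := fun d hd => (wtop_wtop _ _ hd).1.le
    have hle : (da 0 * s + db 0 * s + lh : ℚ) ≤ l := by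
      by_contra hcon
      exact hnz (wtop_eq_zero hfl (not_le.1 hcon))
    rw [← ha1, hwt] at hle
    have : ((s * (da 0 + db 0) : ℕ) : ℚ) ≤ ((s * da 0 + da 1 : ℕ) : ℚ) := by
      push_cast at hle ⊢; linarith
    exact_mod_cast this
  · intro d hd
    have := hl d hd
    rw [← ha1, hwt, hwt] at this
    exact_mod_cast this

/-- there is a monomial of maximal x-degree divisible by y -/
def flag (f : MvPolynomial (Fin 2) k) : Prop := ∃ d, coeff d f ≠ 0 ∧ d 0 = degreeOf 0 f ∧ 1 ≤ d 1

lemma coeff_sw (f : MvPolynomial (Fin 2) k) (d : Fin 2 →₀ ℕ) (hd : coeff d f ≠ 0) :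
    ∃ e, coeff e (sw f) ≠ 0 ∧ e 0 = d 1 ∧ e 1 = d 0 := by
  refine ⟨d.mapDomain (Equiv.swap 0 1), ?_, ?_, ?_⟩
  · change coeff _ (rename (Equiv.swap (0 : Fin 2) 1) f) ≠ 0
    rwa [coeff_rename_mapDomain _ (Equiv.injective _)]
  · have := Finsupp.mapDomain_apply (Equiv.injective (Equiv.swap (0 : Fin 2) 1)) d 1
    simpa using this
  · have := Finsupp.mapDomain_apply (Equiv.injective (Equiv.swap (0 : Fin 2) 1)) d 0
    simpa using this

lemma degreeOf_sw_le (f : MvPolynomial (Fin 2) k) :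
    degreeOf 0 (sw f) ≤ degreeOf 1 f ∧ degreeOf 1 (sw f) ≤ degreeOf 0 f := by
  rw [degreeOf_le_iff, degreeOf_le_iff]
  constructor <;> intro d hd
  · obtain ⟨e, he, h0, h1⟩ := coeff_sw (sw f) d (by simpa using hd)
    rw [sw_sw] at he
    rw [← h1]; exact monomial_le_degreeOf _ (by simpa using he)
  · obtain ⟨e, he, h0, h1⟩ := coeff_sw (sw f) d (by simpa using hd)
    rw [sw_sw] at he
    rw [← h0]; exact monomial_le_degreeOf _ (by simpa using he)

lemma degreeOf_sw (f : MvPolynomial (Fin 2) k) :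
    degreeOf 0 (sw f) = degreeOf 1 f ∧ degreeOf 1 (sw f) = degreeOf 0 f := by
  have h1 := degreeOf_sw_le f
  have h2 := degreeOf_sw_le (sw f)
  rw [sw_sw] at h2
  omega

/-- One step of the reduction. -/
lemma lemmaS (P : Polynomial k) (hs : 1 ≤ P.natDegree) {f : MvPolynomial (Fin 2) k} (hf : f ≠ 0) :
    P.natDegree * degreeOf 0 f ≤ degreeOf 0 (sw (el P f)) + degreeOf 1 f ∧
    (flag f → P.natDegree * degreeOf 0 f + 1 ≤ degreeOf 0 (sw (el P f)) + degreeOf 1 f) ∧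
    (1 ≤ degreeOf 1 f →
      P.natDegree * degreeOf 0 f + 1 ≤ degreeOf 0 (sw (el P f)) + degreeOf 1 f ∨
      flag (sw (el P f))) := by
  obtain ⟨da, db, ha, hb, h1, h2, h3⟩ := lemmaS_core P hs hf
  have ea := monomial_le_degreeOf 1 (mem_support_iff.2 ha)
  have eb := monomial_le_degreeOf 1 (mem_support_iff.2 hb)
  rw [← (degreeOf_sw (el P f)).1] at eb
  rw [mul_add] at h2
  obtain ⟨d, hd, hd0⟩ := exists_degreeOf hf 0
  have h4 := h3 d hd
  rw [hd0] at h4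
  refine ⟨by omega, ?_, ?_⟩
  · rintro ⟨d', hd', hd0', hd1'⟩
    have h5 := h3 d' hd'
    rw [hd0'] at h5
    omega
  · intro hδ
    by_cases hb0 : db 0 = 0
    · left; rw [hb0] at h1; omega
    · by_cases heq : db 1 = degreeOf 0 (sw (el P f))
      · right
        obtain ⟨e, he, he0, he1⟩ := coeff_sw _ db hb
        exact ⟨e, he, by omega, by omega⟩
      · left; omega

lemma el_degreeOf0_le (P : Polynomial k) (f : MvPolynomial (Fin 2) k) :
    degreeOf 0 (el P f) ≤ degreeOf 0 f := by
  have hW : ∀ i, WLe ![1, 0] ((![1, 0] : Fin 2 → ℚ) i) ((el P).toAlgHom (X i)) := by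
    have hX1 : WLe ![1, 0] 0 (X 1 : MvPolynomial (Fin 2) k) := WLe.X (w := ![1, 0]) 1
    intro i; fin_cases i
    · change WLe ![1, 0] 1 (el P (X 0))
      rw [el_X0]
      have := WLe_aeval le_rfl hX1 P
      rw [mul_zero] at this
      exact WLe.add (WLe.X (w := ![1, 0]) 0) (this.mono zero_le_one)
    · change WLe ![1, 0] 0 (el P (X 1))
      rw [el_X1]
      exact hX1
  have := subst_le (el P).toAlgHom hW (l := degreeOf 0 f) (g := f) (by
    intro d hd
    rw [wt_two]
    have := monomial_le_degreeOf 0 (mem_support_iff.2 hd)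
    simpa using this)
  rw [degreeOf_le_iff]
  intro d hd
  have h2 := this d (by simpa using hd)
  rw [wt_two] at h2
  simpa using h2

lemma el_degreeOf0 (P : Polynomial k) (f : MvPolynomial (Fin 2) k) :
    degreeOf 0 (el P f) = degreeOf 0 f := by
  refine le_antisymm (el_degreeOf0_le P f) ?_
  have h1 := el_degreeOf0_le (-P) (el P f)
  have h2 : el (-P) (el P f) = f := by
    have : (el (-P)).toAlgHom.comp (el P).toAlgHom = AlgHom.id k _ := by
      ext1 i
      fin_cases i
      · change el (-P) (el P (X 0)) = X 0
        rw [el_X0, map_add, el_X0]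
        have := Polynomial.aeval_algHom_apply (el (-P)).toAlgHom (X 1) P
        have h3 : (el (-P)) (Polynomial.aeval (X 1) P) = Polynomial.aeval (X 1) P := by
          have h4 : (el (-P)).toAlgHom (X 1) = X 1 := el_X1 _
          rw [h4] at this
          exact this.symm
        rw [h3]; simp
      · change el (-P) (el P (X 1)) = X 1
        rw [el_X1, el_X1]
    exact congrArg (fun F => F f) this
  rwa [h2] at h1

/-- the next automorphism in the reduction -/
noncomputable def nx (P : Polynomial k) (φ : MvPolynomial (Fin 2) k ≃ₐ[k] MvPolynomial (Fin 2) k) :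
    MvPolynomial (Fin 2) k ≃ₐ[k] MvPolynomial (Fin 2) k :=
  sw.trans ((el P).symm.trans φ)

lemma nx_X0 (P : Polynomial k) (φ : MvPolynomial (Fin 2) k ≃ₐ[k] MvPolynomial (Fin 2) k) :
    nx P φ (X 0) = φ (X 1) := by
  rw [nx, AlgEquiv.trans_apply, sw_X0, el_symm_trans_X1]

lemma nx_X1 (P : Polynomial k) (φ : MvPolynomial (Fin 2) k ≃ₐ[k] MvPolynomial (Fin 2) k) :
    nx P φ (X 1) = φ (X 0) - Polynomial.aeval (φ (X 1)) P := by
  rw [nx, AlgEquiv.trans_apply, sw_X1, el_symm_trans_X0]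

lemma nx_f (P : Polynomial k) (φ : MvPolynomial (Fin 2) k ≃ₐ[k] MvPolynomial (Fin 2) k)
    (f : MvPolynomial (Fin 2) k) : nx P φ (sw (el P f)) = φ f := by
  rw [nx, AlgEquiv.trans_apply, sw_sw, AlgEquiv.trans_apply, AlgEquiv.symm_apply_apply]

lemma nx_deg1 (P : Polynomial k) (f : MvPolynomial (Fin 2) k) :
    degreeOf 1 (sw (el P f)) = degreeOf 0 f := by
  rw [(degreeOf_sw _).2, el_degreeOf0]

lemma nx_ne (P : Polynomial k) {f : MvPolynomial (Fin 2) k} (hf : f ≠ 0) : sw (el P f) ≠ 0 := by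
  simpa using hf

lemma nx_end (P : Polynomial k) (φ : MvPolynomial (Fin 2) k ≃ₐ[k] MvPolynomial (Fin 2) k)
    (f : MvPolynomial (Fin 2) k) (h1 : (φ (X 1)).totalDegree ≤ 1)
    (h2 : (φ (X 0) - Polynomial.aeval (φ (X 1)) P).totalDegree ≤ 1) :
    degreeOf 0 (sw (el P f)) ≤ (φ f).totalDegree := by
  have := aff_td_le (nx P φ) (by rw [nx_X0]; exact h1) (by rw [nx_X1]; exact h2) (sw (el P f))
  rw [nx_f] at this
  exact (degreeOf_le_totalDegree _ _).trans this

lemma lemmaInc (n : ℕ) : ∀ (φ : MvPolynomial (Fin 2) k ≃ₐ[k] MvPolynomial (Fin 2) k)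
    (f : MvPolynomial (Fin 2) k), f ≠ 0 → (φ (X 0)).totalDegree ≤ n →
    (φ (X 1)).totalDegree < (φ (X 0)).totalDegree → degreeOf 1 f ≤ degreeOf 0 f →
    degreeOf 0 f ≤ (φ f).totalDegree := by
  induction n with
  | zero => intro φ f _ h1 h2; omega
  | succ n ih =>
    intro φ f hf h1 h2 h3
    obtain ⟨P, hP1, hP2, hP3⟩ := lemmaJ2 φ h2
    obtain ⟨hS, -, -⟩ := lemmaS P (by omega) hf
    have hinc : degreeOf 0 f ≤ degreeOf 0 (sw (el P f)) := by nlinarith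
    rcases hP3 with h | ⟨h, hlast⟩
    · have := ih (nx P φ) (sw (el P f)) (nx_ne P hf) (by rw [nx_X0]; omega)
        (by rw [nx_X0, nx_X1]; exact h) (by rw [nx_deg1]; exact hinc)
      rw [nx_f] at this
      omega
    · exact hinc.trans (nx_end P φ f (by omega) hlast)

/-- `f` is not a polynomial in a coordinate -/
def NC (f : MvPolynomial (Fin 2) k) : Prop :=
  ∀ ψ : MvPolynomial (Fin 2) k ≃ₐ[k] MvPolynomial (Fin 2) k, degreeOf 0 (ψ f) ≠ 0

lemma NC.map {f : MvPolynomial (Fin 2) k} (h : NC f)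
    (χ : MvPolynomial (Fin 2) k ≃ₐ[k] MvPolynomial (Fin 2) k) : NC (χ f) := by
  intro ψ; exact h (χ.trans ψ)

lemma NC.ne {f : MvPolynomial (Fin 2) k} (h : NC f) : f ≠ 0 := by
  rintro rfl; apply h AlgEquiv.refl; simp

lemma lemmaMain (d E : ℕ) : ∀ (φ : MvPolynomial (Fin 2) k ≃ₐ[k] MvPolynomial (Fin 2) k)
    (f : MvPolynomial (Fin 2) k), NC f →
    (φ (X 1)).totalDegree < (φ (X 0)).totalDegree → degreeOf 0 f ≤ d → degreeOf 1 f ≤ d →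
    (φ f).totalDegree ≤ d →
    ((2 * (d + degreeOf 1 f) ≤ E + 2 * degreeOf 0 f ∧ flag f) ∨
      2 * (d + degreeOf 1 f) + 1 ≤ E + 2 * degreeOf 0 f) →
    (φ (X 0)).totalDegree ≤ (2 * d) ^ (E + 1) := by
  induction E with
  | zero =>
    intro φ f hNC h2 hd0 hd1 hd hE
    have hf := hNC.ne
    obtain ⟨P, hP1, hP2, hP3⟩ := lemmaJ2 φ h2
    obtain ⟨hS1, hS2, hS3⟩ := lemmaS P (by omega) hf
    have e0 : 1 ≤ degreeOf 0 f := Nat.one_le_iff_ne_zero.2 (hNC AlgEquiv.refl)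
    have hbd : degreeOf 0 (sw (el P f)) ≤ d := by
      rcases hP3 with h | ⟨h, h'⟩
      · by_cases hc : degreeOf 0 f ≤ degreeOf 0 (sw (el P f))
        · have := lemmaInc _ (nx P φ) (sw (el P f)) (nx_ne P hf) le_rfl
            (by rw [nx_X0, nx_X1]; exact h) (by rw [nx_deg1]; exact hc)
          rw [nx_f] at this
          omega
        · omega
      · exact (nx_end P φ f (by omega) h').trans hd
    exfalso
    have h3 : 2 * degreeOf 0 f ≤ P.natDegree * degreeOf 0 f := Nat.mul_le_mul_right _ hP2
    rcases hE with ⟨hE, hfl⟩ | hE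
    · have := hS2 hfl
      omega
    · omega
  | succ E ih =>
    intro φ f hNC h2 hd0 hd1 hd hE
    have hf := hNC.ne
    obtain ⟨P, hP1, hP2, hP3⟩ := lemmaJ2 φ h2
    obtain ⟨hS1, hS2, hS3⟩ := lemmaS P (by omega) hf
    have e0 : 1 ≤ degreeOf 0 f := Nat.one_le_iff_ne_zero.2 (hNC AlgEquiv.refl)
    have e1 : 1 ≤ degreeOf 1 f := by
      have := hNC sw
      rw [(degreeOf_sw f).1] at this
      omega
    have hbd : degreeOf 0 (sw (el P f)) ≤ d := by
      rcases hP3 with h | ⟨h, h'⟩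
      · by_cases hc : degreeOf 0 f ≤ degreeOf 0 (sw (el P f))
        · have := lemmaInc _ (nx P φ) (sw (el P f)) (nx_ne P hf) le_rfl
            (by rw [nx_X0, nx_X1]; exact h) (by rw [nx_deg1]; exact hc)
          rw [nx_f] at this
          omega
        · omega
      · exact (nx_end P φ f (by omega) h').trans hd
    have h3 : 2 * degreeOf 0 f ≤ P.natDegree * degreeOf 0 f := Nat.mul_le_mul_right _ hP2
    have hs2d : P.natDegree ≤ 2 * d := by
      have : P.natDegree * 1 ≤ P.natDegree * degreeOf 0 f := Nat.mul_le_mul_left _ e0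
      omega
    rcases hP3 with h | ⟨h, h'⟩
    · have := ih (nx P φ) (sw (el P f)) ((hNC.map (el P)).map sw)
        (by rw [nx_X0, nx_X1]; exact h) hbd (by rw [nx_deg1]; exact hd0)
        (by rw [nx_f]; exact hd)
        (by
          rw [nx_deg1]
          rcases hE with ⟨hE, hfl⟩ | hE
          · have := hS2 hfl
            right; omega
          · rcases hS3 e1 with h4 | h4
            · right; omega
            · left; exact ⟨by omega, h4⟩)
      rw [nx_X0] at this
      rw [hP1, pow_succ, mul_comm]
      exact Nat.mul_le_mul this hs2d
    · rw [hP1, h, mul_one]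
      have hd1 : 1 ≤ 2 * d := by omega
      exact hs2d.trans (Nat.le_self_pow (by omega) _)

lemma lemmaBound (d : ℕ) (φ : MvPolynomial (Fin 2) k ≃ₐ[k] MvPolynomial (Fin 2) k)
    (f : MvPolynomial (Fin 2) k) (hNC : NC f)
    (h2 : (φ (X 1)).totalDegree < (φ (X 0)).totalDegree) (h3 : f.totalDegree ≤ d)
    (h4 : (φ f).totalDegree ≤ d) : (φ (X 0)).totalDegree ≤ (2 * d) ^ (4 * d + 2) := by
  have e0 := degreeOf_le_totalDegree f 0
  have e1 := degreeOf_le_totalDegree f 1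
  exact lemmaMain d (4 * d + 1) φ f hNC h2 (by omega) (by omega) h4 (Or.inr (by omega))

lemma sw_td (f : MvPolynomial (Fin 2) k) : (sw f).totalDegree ≤ f.totalDegree := by
  exact totalDegree_rename_le _ f

lemma noncoord_bound (φ : MvPolynomial (Fin 2) k ≃ₐ[k] MvPolynomial (Fin 2) k)
    (f : MvPolynomial (Fin 2) k) (hNC : NC f) (hφ : φ f = f) :
    max (φ (X 0)).totalDegree (φ (X 1)).totalDegree
      ≤ max 1 ((2 * f.totalDegree) ^ (4 * f.totalDegree + 2)) := by
  rcases lt_trichotomy (φ (X 1)).totalDegree (φ (X 0)).totalDegree with h | h | h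
  · rw [max_eq_left h.le]
    exact le_max_of_le_right (lemmaBound _ φ f hNC h le_rfl (by rw [hφ]))
  · rw [h, max_self]
    by_cases h1 : (φ (X 0)).totalDegree ≤ 1
    · exact le_max_of_le_left h1
    obtain ⟨c, r, hc, hr, hrr, hl⟩ := J1_ge2 φ h.le (by omega)
    have hr1 : r = 1 := by
      rw [h] at hrr
      by_contra hne
      have : 2 ≤ r := by omega
      nlinarith
    subst hr1
    rw [pow_one] at hl
    set P : Polynomial k := Polynomial.C c * Polynomial.X with hP
    have hPa : ∀ q : MvPolynomial (Fin 2) k, Polynomial.aeval q P = C c * q := by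
      intro q; simp [hP, algebraMap_eq]
    have htd : (sw (el P f)).totalDegree ≤ f.totalDegree := by
      refine (sw_td _).trans ?_
      rw [td_le_iff]
      refine subst_le (el P).toAlgHom (w := w1) ?_ ((td_le_iff _ _).1 le_rfl)
      have hX : ∀ i, WLe w1 1 (X i : MvPolynomial (Fin 2) k) := fun i => WLe.X (w := w1) i
      intro i; fin_cases i
      · change WLe w1 1 (el P (X 0))
        rw [el_X0, hPa]
        refine (hX 0).add ?_
        have := (WLe.C (w := w1) c).mul (hX 1)
        simpa using this
      · change WLe w1 1 (el P (X 1))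
        rw [el_X1]; exact hX 1
    have := lemmaBound f.totalDegree (nx P φ) (sw (el P f)) ((hNC.map (el P)).map sw)
      (by rw [nx_X0, nx_X1, hPa, h]; exact hl) htd (by rw [nx_f, hφ])
    rw [nx_X0, h] at this
    exact le_max_of_le_right this
  · rw [max_eq_right h.le]
    have := lemmaBound f.totalDegree (sw.trans φ) (sw f) (hNC.map sw)
      (by rw [AlgEquiv.trans_apply, AlgEquiv.trans_apply, sw_X0, sw_X1]; exact h)
      (sw_td f) (by rw [AlgEquiv.trans_apply, sw_sw, hφ])
    rw [AlgEquiv.trans_apply, sw_X0] at this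
    exact le_max_of_le_right this

lemma exists_poly_of_degreeOf {F : MvPolynomial (Fin 2) k} (h0 : degreeOf 0 F = 0) :
    ∃ h : Polynomial k, F = Polynomial.aeval (X 1) h := by
  refine ⟨∑ d ∈ F.support, Polynomial.monomial (d 1) (coeff d F), ?_⟩
  rw [map_sum]
  conv_lhs => rw [F.as_sum]
  refine Finset.sum_congr rfl fun d hd => ?_
  have hd0 : d 0 = 0 := by
    have := monomial_le_degreeOf (0 : Fin 2) hd
    omega
  rw [Polynomial.aeval_monomial, monomial_eq, Finsupp.prod_fintype _ _ (by simp),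
    Fin.prod_univ_two, hd0]
  simp [algebraMap_eq]

lemma coord_fix {h : Polynomial k} (hn : 1 ≤ h.natDegree) {w : Fin 2 → ℚ} (hw : w 1 = 1)
    {q : MvPolynomial (Fin 2) k} (hq : q ≠ 0)
    (he : Polynomial.aeval q h = Polynomial.aeval (X 1) h) : WLe w 1 q := by
  obtain ⟨l, hl, hne, -⟩ := exists_wtop w hq
  refine hl.mono ?_
  by_contra hlt
  push Not at hlt
  have hn' : (1 : ℚ) ≤ h.natDegree := by exact_mod_cast hn
  have hF : WLe w (h.natDegree * 1) (Polynomial.aeval (X 1 : MvPolynomial (Fin 2) k) h) :=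
    WLe_aeval zero_le_one (hw ▸ WLe.X 1) h
  have h1 : wtop w (h.natDegree * l) (Polynomial.aeval q h) = 0 := by
    rw [he]; exact wtop_eq_zero hF (by nlinarith)
  have hE : WLe w (h.eraseLead.natDegree * l) (Polynomial.aeval q h.eraseLead) :=
    WLe_aeval (by linarith) hl _
  have h2 : wtop w (h.natDegree * l) (Polynomial.aeval q h.eraseLead) = 0 := by
    refine wtop_eq_zero hE ?_
    have h3 : h.eraseLead.natDegree < h.natDegree := by
      have := h.eraseLead_natDegree_le
      omega
    have : (h.eraseLead.natDegree : ℚ) < h.natDegree := by exact_mod_cast h3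
    exact mul_lt_mul_of_pos_right this (by linarith)
  have h4 : Polynomial.aeval q h = Polynomial.aeval q h.eraseLead + C h.leadingCoeff * q ^ h.natDegree := by
    have e := congrArg (Polynomial.aeval q) h.eraseLead_add_C_mul_X_pow
    rw [map_add, map_mul, map_pow, Polynomial.aeval_C, Polynomial.aeval_X] at e
    exact e.symm
  rw [h4, wtop_add, h2, zero_add] at h1
  have h5 := wtop_mul (WLe.C (w := w) h.leadingCoeff) (hl.pow h.natDegree)
  rw [zero_add, h1, wtop_C, wtop_pow hl] at h5
  have h6 : h.leadingCoeff ≠ 0 := by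
    rw [Polynomial.leadingCoeff_ne_zero]; rintro rfl; simp at hn
  exact mul_ne_zero (by simpa using h6) (pow_ne_zero _ hne) h5.symm

def Pres (w : Fin 2 → ℚ) (φ : MvPolynomial (Fin 2) k ≃ₐ[k] MvPolynomial (Fin 2) k) : Prop :=
  ∀ l g, WLe w l g → WLe w l (φ g)

lemma td_to_w {w : Fin 2 → ℚ} {N : ℕ} (hw0 : w 0 ≤ N) (hw1 : w 1 ≤ N)
    {g : MvPolynomial (Fin 2) k} {n : ℕ} (h : g.totalDegree ≤ n) : WLe w (N * n) g := by
  rw [td_le_iff] at h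
  intro d hd
  have := h d hd
  rw [wt_w1] at this
  push_cast at this
  rw [wt_two]
  have a : (0 : ℚ) ≤ d 0 := by positivity
  have b : (0 : ℚ) ≤ d 1 := by positivity
  have c : (0 : ℚ) ≤ N := by positivity
  nlinarith [mul_le_mul_of_nonneg_left hw0 a, mul_le_mul_of_nonneg_left hw1 b,
    mul_le_mul_of_nonneg_left this c]

lemma w_to_td {w : Fin 2 → ℚ} (hw0 : 1 ≤ w 0) (hw1 : 1 ≤ w 1)
    {g : MvPolynomial (Fin 2) k} {n : ℕ} (h : WLe w n g) : g.totalDegree ≤ n := by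
  rw [td_le_iff]
  intro d hd
  have := h d hd
  rw [wt_two] at this
  rw [wt_w1]
  push_cast
  have a : (0 : ℚ) ≤ d 0 := by positivity
  have b : (0 : ℚ) ≤ d 1 := by positivity
  nlinarith [mul_le_mul_of_nonneg_left hw0 a, mul_le_mul_of_nonneg_left hw1 b]

lemma td_map_le (φ : MvPolynomial (Fin 2) k ≃ₐ[k] MvPolynomial (Fin 2) k)
    (g : MvPolynomial (Fin 2) k) :
    (φ g).totalDegree ≤ max (φ (X 0)).totalDegree (φ (X 1)).totalDegree * g.totalDegree := by
  rw [td_le_iff]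
  push_cast
  refine subst_le (w := fun _ => ((max (φ (X 0)).totalDegree (φ (X 1)).totalDegree : ℕ) : ℚ))
    (φ : MvPolynomial (Fin 2) k →ₐ[k] MvPolynomial (Fin 2) k) ?_ ?_
  · intro i
    refine (td_le_iff _ _).1 ?_
    fin_cases i
    · exact le_max_left _ _
    · exact le_max_right _ _
  · rw [← Nat.cast_max]
    exact td_to_w le_rfl le_rfl le_rfl

lemma pres_of_fix {h : Polynomial k} (hn : 1 ≤ h.natDegree)
    (φ : MvPolynomial (Fin 2) k ≃ₐ[k] MvPolynomial (Fin 2) k)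
    (hφ : φ (Polynomial.aeval (X 1) h) = Polynomial.aeval (X 1) h) {N : ℕ}
    (hN1 : 1 ≤ N) (hN : (φ (X 0)).totalDegree ≤ N) : Pres ![(N : ℚ), 1] φ := by
  have he : Polynomial.aeval (φ (X 1)) h = Polynomial.aeval (X 1) h := by
    rw [← hφ]; exact (Polynomial.aeval_algHom_apply (φ : MvPolynomial (Fin 2) k →ₐ[k] MvPolynomial (Fin 2) k) (X 1) h)
  have hq : ∀ w : Fin 2 → ℚ, w 1 = 1 → WLe w 1 (φ (X 1)) := fun w hw =>
    coord_fix hn hw (phi_ne φ 1) he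
  have hq1 : (φ (X 1)).totalDegree = 1 := by
    refine le_antisymm ?_ (td_pos φ 1)
    rw [td_le_iff]; exact_mod_cast hq w1 rfl
  obtain ⟨P, hP, hP2⟩ := lemmaJ2_aux _ φ le_rfl
  rw [hq1] at hP hP2
  have hN' : (1 : ℚ) ≤ N := by exact_mod_cast hN1
  have h2 : (φ (X 0) - Polynomial.aeval (φ (X 1)) P).totalDegree ≤ 1 := by
    rcases hP2 with h | h <;> omega
  have h3 : WLe ![(N : ℚ), 1] (N * (1 : ℕ)) (φ (X 0) - Polynomial.aeval (φ (X 1)) P) :=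
    td_to_w (by simp) (by simpa using hN1) h2
  have h4 := WLe_aeval zero_le_one (hq ![(N : ℚ), 1] (by simp)) P
  have h5 : WLe ![(N : ℚ), 1] N (φ (X 0)) := by
    have e : φ (X 0) = (φ (X 0) - Polynomial.aeval (φ (X 1)) P) + Polynomial.aeval (φ (X 1)) P := by
      ring
    rw [e]
    refine WLe.add (h3.mono (by simp)) (h4.mono ?_)
    have : (P.natDegree : ℚ) ≤ N := by
      have : P.natDegree ≤ N := by omega
      exact_mod_cast this
    linarith
  intro l g hg
  refine subst_le (φ : MvPolynomial (Fin 2) k →ₐ[k] MvPolynomial (Fin 2) k) ?_ hg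
  intro i
  fin_cases i
  · simpa using h5
  · simpa using hq ![(N : ℚ), 1] (by simp)

lemma coord_bound (Γ : Subgroup (MvPolynomial (Fin 2) k ≃ₐ[k] MvPolynomial (Fin 2) k))
    (hΓ : Γ.FG) (f : MvPolynomial (Fin 2) k) (hf : ∀ φ ∈ Γ, φ f = f)
    (hc : ∀ c, f ≠ C c)
    (ψ : MvPolynomial (Fin 2) k ≃ₐ[k] MvPolynomial (Fin 2) k) (h0 : degreeOf 0 (ψ f) = 0) :
    ∃ N : ℕ, ∀ φ ∈ Γ, max (φ (X 0)).totalDegree (φ (X 1)).totalDegree ≤ N := by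
  obtain ⟨h, hh⟩ := exists_poly_of_degreeOf h0
  have hn : 1 ≤ h.natDegree := by
    by_contra hlt
    have e : h.natDegree = 0 := by omega
    rw [Polynomial.eq_C_of_natDegree_eq_zero e, Polynomial.aeval_C] at hh
    apply hc (h.coeff 0)
    apply ψ.injective
    rw [hh, ← algebraMap_eq, AlgEquiv.commutes]
  let cj : (MvPolynomial (Fin 2) k ≃ₐ[k] MvPolynomial (Fin 2) k) →
    (MvPolynomial (Fin 2) k ≃ₐ[k] MvPolynomial (Fin 2) k) := fun γ => ψ.symm.trans (γ.trans ψ)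
  have hcj : ∀ γ g, cj γ g = ψ (γ (ψ.symm g)) := fun γ g => rfl
  obtain ⟨S, hS⟩ := hΓ
  let N : ℕ := 1 + ∑ s ∈ S, (((cj s) (X 0)).totalDegree + ((cj s⁻¹) (X 0)).totalDegree)
  have hfix : ∀ γ ∈ Γ, cj γ (Polynomial.aeval (X 1) h) = Polynomial.aeval (X 1) h := by
    intro γ hγ
    rw [hcj, ← hh, AlgEquiv.symm_apply_apply, hf γ hγ]
  have hNs : ∀ s ∈ S, ((cj s) (X 0)).totalDegree ≤ N ∧ ((cj s⁻¹) (X 0)).totalDegree ≤ N := by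
    intro s hs
    have := Finset.single_le_sum (f := fun s => ((cj s) (X 0)).totalDegree
      + ((cj s⁻¹) (X 0)).totalDegree) (fun _ _ => Nat.zero_le _) hs
    constructor <;> (simp only [N]; omega)
  have hN1 : 1 ≤ N := by simp only [N]; omega
  have hpres : ∀ γ ∈ Γ, Pres ![(N : ℚ), 1] (cj γ) ∧ Pres ![(N : ℚ), 1] (cj γ⁻¹) := by
    intro γ hγ
    rw [← hS] at hγ
    induction hγ using Subgroup.closure_induction with
    | mem s hs =>
      have hsΓ : s ∈ Γ := by rw [← hS]; exact Subgroup.subset_closure hs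
      exact ⟨pres_of_fix hn _ (hfix s hsΓ) hN1 (hNs s hs).1,
        pres_of_fix hn _ (hfix s⁻¹ (Γ.inv_mem hsΓ)) hN1 (hNs s hs).2⟩
    | one =>
      have : Pres ![(N : ℚ), 1] (cj 1) := by
        intro l g hg
        rw [hcj]; simpa using hg
      exact ⟨this, by rw [inv_one]; exact this⟩
    | mul a b _ _ ha hb =>
      have key : ∀ a b, Pres ![(N : ℚ), 1] (cj a) → Pres ![(N : ℚ), 1] (cj b) →
          Pres ![(N : ℚ), 1] (cj (a * b)) := by
        intro a b ha hb l g hg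
        have := ha l _ (hb l g hg)
        rw [hcj, hcj, AlgEquiv.symm_apply_apply] at this
        rw [hcj]; exact this
      refine ⟨key _ _ ha.1 hb.1, ?_⟩
      rw [mul_inv_rev]
      exact key _ _ hb.2 ha.2
    | inv a _ ha => exact ⟨ha.2, by rw [inv_inv]; exact ha.1⟩
  let A := max (ψ (X 0)).totalDegree (ψ (X 1)).totalDegree
  let B := max (ψ.symm (X 0)).totalDegree (ψ.symm (X 1)).totalDegree
  refine ⟨B * (N * A), fun γ hγ => ?_⟩
  have key : ∀ i, (ψ (X i)).totalDegree ≤ A → (γ (X i)).totalDegree ≤ B * (N * A) := by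
    intro i hi
    have h1 : WLe ![(N : ℚ), 1] (N * A) (ψ (X i)) :=
      td_to_w (by simp) (by simpa using hN1) hi
    have h2 := (hpres γ hγ).1 _ _ h1
    have h3 : (cj γ (ψ (X i))).totalDegree ≤ N * A :=
      w_to_td (w := ![(N : ℚ), 1]) (by simpa using hN1) (by simp) (by push_cast; exact h2)
    have h4 : γ (X i) = ψ.symm (cj γ (ψ (X i))) := by
      rw [hcj]; simp
    rw [h4]
    exact (td_map_le _ _).trans (Nat.mul_le_mul_left _ h3)
  exact max_le (key 0 (le_max_left _ _)) (key 1 (le_max_right _ _))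

lemma final (Γ : Subgroup (MvPolynomial (Fin 2) k ≃ₐ[k] MvPolynomial (Fin 2) k))
    (hΓ : Γ.FG)
    (hub : ¬ ∃ N : ℕ, ∀ φ ∈ Γ, max (φ (X 0)).totalDegree (φ (X 1)).totalDegree ≤ N) :
    {f : MvPolynomial (Fin 2) k | ∀ φ ∈ Γ, φ f = f} =
      Set.range (fun c : k => (C c : MvPolynomial (Fin 2) k)) := by
  ext f
  simp only [Set.mem_setOf_eq, Set.mem_range]
  constructor
  · intro hf
    by_contra hc
    push Not at hc
    apply hub
    by_cases hNC : NC f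
    · exact ⟨_, fun φ hφ => noncoord_bound φ f hNC (hf φ hφ)⟩
    · unfold NC at hNC
      push Not at hNC
      obtain ⟨ψ, hψ⟩ := hNC
      exact coord_bound Γ hΓ f hf (fun c => (hc c).symm) ψ hψ
  · rintro ⟨c, rfl⟩ φ _
    exact φ.commutes c

theorem stmt8 (Γ : Subgroup (MvPolynomial (Fin 2) k ≃ₐ[k] MvPolynomial (Fin 2) k))
    (hΓ : Γ.FG)
    (hub : ¬ ∃ N : ℕ, ∀ φ ∈ Γ, adeg φ ≤ N) :
    {f : MvPolynomial (Fin 2) k | ∀ φ ∈ Γ, φ f = f} =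
      Set.range (fun c : k => (C c : MvPolynomial (Fin 2) k)) := by
  exact final Γ hΓ hub
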